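/- arXiv:math/0502146 — 6 statements merged into one kernel-verified Lean document; each statement's English description precedes it below -/
import Mathlib

section
/- A sequence {a_i}_{i≥0} of non-negative integers is an O-sequence if and only if there exist a field k, an integer n ≥ 1, and a homogeneous ideal I ⊆ k[x_0,…,x_{n-1}] such that a_i = dim_k (k[x_0,…,x_{n-1}]/I)_i for every i ≥ 0; that is, the O-sequences are exactly the Hilbert functions of standard graded k-algebras. -/
open MvPolynomial

/-- Greedy top term `m_i` of the `i`-binomial expansion of `a`. -/
def binomExpTop (a i : ℕ) : ℕ :=
  Nat.findGreatest (fun m => Nat.choose m i ≤ a) (a + i)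

/-- Macaulay growth function: `macaulayGrow i a = a^⟨i⟩`, with `0^⟨i⟩ = 0`.
If `a = C(m_i,i) + C(m_{i-1},i-1) + … + C(m_j,j)` is the `i`-binomial expansion
(computed greedily), then `a^⟨i⟩ = C(m_i+1,i+1) + C(m_{i-1}+1,i) + … + C(m_j+1,j+1)`. -/
def macaulayGrow : ℕ → ℕ → ℕ
  | 0, _ => 0
  | (i + 1), a =>
    if a = 0 then 0
    else Nat.choose (binomExpTop a (i + 1) + 1) (i + 2)
      + macaulayGrow i (a - Nat.choose (binomExpTop a (i + 1)) (i + 1))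

/-- A sequence of non-negative integers is an O-sequence:
`a_0 = 1` and `a_{i+1} ≤ a_i^⟨i⟩` for all `i ≥ 1`. -/
def IsOSequence (a : ℕ → ℕ) : Prop :=
  a 0 = 1 ∧ ∀ i : ℕ, 1 ≤ i → a (i + 1) ≤ macaulayGrow i (a i)

/-- A homogeneous ideal of a polynomial ring: one containing all homogeneous
components of each of its elements. -/
def IsHomogeneousIdeal {k : Type*} [CommSemiring k] {n : ℕ}
    (I : Ideal (MvPolynomial (Fin n) k)) : Prop :=
  ∀ f ∈ I, ∀ i : ℕ, MvPolynomial.homogeneousComponent i f ∈ I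

/-- The degree-`i` graded piece of `R/I`: the image of the space of degree-`i`
homogeneous polynomials in the quotient. -/
noncomputable def quotPiece {k : Type*} [Field k] {n : ℕ}
    (I : Ideal (MvPolynomial (Fin n) k)) (i : ℕ) :
    Submodule k (MvPolynomial (Fin n) k ⧸ I) :=
  (MvPolynomial.homogeneousSubmodule (Fin n) k i).map (Ideal.Quotient.mkₐ k I).toLinearMap

/-- The Hilbert function of `R/I`:  `i ↦ dim_k (R/I)_i`. -/
noncomputable def hilbertFn {k : Type*} [Field k] {n : ℕ}
    (I : Ideal (MvPolynomial (Fin n) k)) (i : ℕ) : ℕ :=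
  Module.finrank k (quotPiece I i)

open Finset in
/-- rank of a monotone sequence. -/
def rk (d : ℕ) (b : ℕ → ℕ) : ℕ := ∑ k ∈ Finset.range d, (b k + k).choose (k + 1)

/-- shift. -/
def sh (b : ℕ → ℕ) : ℕ → ℕ
  | 0 => 0
  | k + 1 => b k

lemma rk_succ (d : ℕ) (b : ℕ → ℕ) : rk (d+1) b = rk d b + (b d + d).choose (d+1) := by
  simp [rk, Finset.sum_range_succ]

lemma rk_zero (b : ℕ → ℕ) : rk 0 b = 0 := by simp [rk]

lemma rk_sh (d : ℕ) (b : ℕ → ℕ) :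
    rk (d+1) (sh b) = ∑ k ∈ Finset.range d, (b k + k + 1).choose (k + 2) := by
  simp [rk, Finset.sum_range_succ', sh, add_assoc]

lemma sh_mono {b : ℕ → ℕ} (hb : Monotone b) : Monotone (sh b) := by
  apply monotone_nat_of_le_succ
  intro k
  cases k with
  | zero => simp [sh]
  | succ k => exact hb (Nat.le_succ k)

lemma rk_lt {d c : ℕ} {b : ℕ → ℕ} (h : ∀ k < d, b k ≤ c) : rk d b < (c + d).choose d := by
  induction d with
  | zero => simp [rk]
  | succ d ih =>
    have h1 := ih (fun k hk => h k (by omega))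
    have h2 : (b d + d).choose (d+1) ≤ (c + d).choose (d+1) :=
      Nat.choose_le_choose _ (by have := h d (by omega); omega)
    rw [rk_succ, ← add_assoc, Nat.choose_succ_succ']
    omega

lemma rk_congr {d : ℕ} {b b' : ℕ → ℕ} (h : ∀ k < d, b k = b' k) : rk d b = rk d b' := by
  unfold rk
  apply Finset.sum_congr rfl
  intro k hk
  rw [h k (Finset.mem_range.1 hk)]

lemma rk_le {d : ℕ} {b b' : ℕ → ℕ} (h : ∀ k < d, b k ≤ b' k) : rk d b ≤ rk d b' := by
  unfold rk
  apply Finset.sum_le_sum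
  intro k hk
  exact Nat.choose_le_choose _ (by have := h k (Finset.mem_range.1 hk); omega)

lemma rk_lt_of {d j : ℕ} {b b' : ℕ → ℕ} (hb : Monotone b) (hj : j < d)
    (h : ∀ k, j < k → k < d → b k = b' k) (hlt : b j < b' j) : rk d b < rk d b' := by
  induction d with
  | zero => omega
  | succ d ih =>
    rw [rk_succ, rk_succ]
    rcases Nat.lt_or_ge j d with hjd | hjd
    · have := ih hjd (fun k h1 h2 => h k h1 (by omega))
      rw [h d hjd (by omega)]
      omega
    · have : j = d := by omega
      subst this
      have h1 : rk j b < (b j + j).choose j := rk_lt (fun k hk => hb hk.le)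
      have h2 : (b j + j + 1).choose (j+1) ≤ (b' j + j).choose (j+1) :=
        Nat.choose_le_choose _ (by omega)
      rw [Nat.choose_succ_succ'] at h2
      omega

lemma seq_trich (d : ℕ) (b b' : ℕ → ℕ) : (∀ k < d, b k = b' k) ∨
    ∃ j < d, b j ≠ b' j ∧ ∀ k, j < k → k < d → b k = b' k := by
  induction d with
  | zero => left; omega
  | succ d ih =>
    by_cases h : b d = b' d
    · rcases ih with h1 | ⟨j, hj, h1, h2⟩
      · left
        intro k hk
        rcases Nat.lt_succ_iff_lt_or_eq.1 hk with hk | rfl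
        · exact h1 k hk
        · exact h
      · right
        refine ⟨j, by omega, h1, fun k h3 h4 => ?_⟩
        rcases Nat.lt_succ_iff_lt_or_eq.1 h4 with hk | rfl
        · exact h2 k h3 hk
        · exact h
    · right
      exact ⟨d, by omega, h, fun k _ _ => by omega⟩

lemma rk_inj {d : ℕ} {b b' : ℕ → ℕ} (hb : Monotone b) (hb' : Monotone b')
    (h : rk d b = rk d b') : ∀ k < d, b k = b' k := by
  rcases seq_trich d b b' with h1 | ⟨j, hj, h1, h2⟩
  · exact h1
  · exfalso
    rcases lt_or_gt_of_ne h1 with h3 | h3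
    · have := rk_lt_of hb hj h2 h3; omega
    · have := rk_lt_of hb' hj (fun k a b => (h2 k a b).symm) h3; omega

/-- lexicographic comparison extracted from ranks -/
lemma rk_lt_iff {d : ℕ} {b b' : ℕ → ℕ} (hb' : Monotone b')
    (h : rk d b < rk d b') : ∃ j < d, b j < b' j ∧ ∀ k, j < k → k < d → b k = b' k := by
  rcases seq_trich d b b' with h1 | ⟨j, hj, h1, h2⟩
  · rw [rk_congr h1] at h; omega
  · rcases lt_or_gt_of_ne h1 with h3 | h3
    · exact ⟨j, hj, h3, h2⟩
    · have := rk_lt_of hb' hj (fun k a b => (h2 k a b).symm) h3; omega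

/-- comparing `sh u` with `b` when the tails compare -/
lemma rk_sh_lt {d : ℕ} {u b : ℕ → ℕ} (hu : Monotone u) (hb : Monotone b)
    (h : rk d u < rk d (fun k => b (k+1))) : rk (d+1) (sh u) < rk (d+1) b := by
  obtain ⟨j, hj, h1, h2⟩ := rk_lt_iff (b' := fun k => b (k+1)) (fun x y hxy => hb (by omega)) h
  refine rk_lt_of (sh_mono hu) (j := j+1) (by omega) (fun k h3 h4 => ?_) h1
  obtain ⟨k, rfl⟩ : ∃ k', k = k' + 1 := ⟨k - 1, by omega⟩
  exact h2 k (by omega) (by omega)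

lemma rk_sh_le {d : ℕ} {u b : ℕ → ℕ} (hu : Monotone u) (hb : Monotone b)
    (h : rk d u ≤ rk d b) : rk (d+1) (sh u) ≤ rk (d+1) (sh b) := by
  rcases h.lt_or_eq with h | h
  · exact (rk_sh_lt hu (sh_mono hb) h).le
  · have := rk_inj hu hb h
    apply le_of_eq
    apply rk_congr
    intro k hk
    cases k with
    | zero => rfl
    | succ k => exact this k (by omega)

lemma exists_rk_aux (d : ℕ) : ∀ c a : ℕ, a < (c + d).choose d →
    ∃ b : ℕ → ℕ, Monotone b ∧ (∀ k, b k ≤ c) ∧ rk d b = a := by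
  induction d with
  | zero =>
    intro c a h
    refine ⟨fun _ => 0, monotone_const, fun _ => Nat.zero_le _, ?_⟩
    simp at h
    simp [rk, h]
  | succ d ih =>
    intro c
    induction c with
    | zero =>
      intro a h
      refine ⟨fun _ => 0, monotone_const, fun _ => Nat.zero_le _, ?_⟩
      simp at h
      simp [rk, h]
    | succ c ihc =>
      intro a h
      rcases Nat.lt_or_ge a ((c + (d+1)).choose (d+1)) with h1 | h1
      · obtain ⟨b, h2, h3, h4⟩ := ihc a h1
        exact ⟨b, h2, fun k => (h3 k).trans (by omega), h4⟩
      · have h5 : (c + 1 + (d + 1)).choose (d+1) = (c+1+d).choose d + (c + 1 + d).choose (d+1) := by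
          rw [← add_assoc, Nat.choose_succ_succ']
        have h6 : c + (d+1) = c + 1 + d := by omega
        rw [h6] at h1
        obtain ⟨b, h2, h3, h4⟩ := ih (c+1) (a - (c+1+d).choose (d+1)) (by omega)
        refine ⟨fun k => if k < d then b k else c+1, ?_, ?_, ?_⟩
        · intro x y hxy
          have h7 := h2 hxy
          have h8 := h3 x
          dsimp only
          split_ifs <;> omega
        · intro k
          have h8 := h3 k
          dsimp only
          split_ifs <;> omega
        · rw [rk_succ, rk_congr (b' := b) (fun k hk => by simp [hk]), h4]
          simp
          omega

lemma exists_rk {d : ℕ} (hd : 1 ≤ d) (a : ℕ) : ∃ b : ℕ → ℕ, Monotone b ∧ rk d b = a := by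
  obtain ⟨b, h1, _, h2⟩ := exists_rk_aux d a a (by
    obtain ⟨e, rfl⟩ : ∃ e, d = e + 1 := ⟨d - 1, by omega⟩
    clear hd
    have : ∀ a, a < (a + (e+1)).choose (e+1) := by
      intro a
      induction a with
      | zero => simp
      | succ a ih =>
        have h : a + 1 + (e+1) = (a + (e+1)) + 1 := by omega
        rw [h, Nat.choose_succ_succ']
        have : 0 < (a + (e+1)).choose e := Nat.choose_pos (by omega)
        omega
    exact this a)
  exact ⟨b, h1, h2⟩

lemma binomExpTop_eq {a i m : ℕ} (hm : i + 1 ≤ m) (h1 : m.choose (i+1) ≤ a)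
    (h2 : a < (m+1).choose (i+1)) : binomExpTop a (i+1) = m := by
  unfold binomExpTop
  rw [Nat.findGreatest_eq_iff]
  refine ⟨?_, fun _ => h1, fun n hn _ h3 => ?_⟩
  · have : ∀ t, t < (t + (i+1)).choose (i+1) := by
      intro a
      induction a with
      | zero => simp
      | succ a ih =>
        have h : a + 1 + (i+1) = (a + (i+1)) + 1 := by omega
        rw [h, Nat.choose_succ_succ']
        have : 0 < (a + (i+1)).choose i := Nat.choose_pos (by omega)
        omega
    have h4 := this (m - (i+1))
    rw [Nat.sub_add_cancel hm] at h4
    omega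
  · have : (m+1).choose (i+1) ≤ n.choose (i+1) := Nat.choose_le_choose _ hn
    omega

lemma grow_zero (d : ℕ) : macaulayGrow d 0 = 0 := by
  cases d <;> simp [macaulayGrow]

lemma grow_rk (d : ℕ) {b : ℕ → ℕ} (hb : Monotone b) :
    macaulayGrow d (rk d b) = rk (d+1) (sh b) := by
  rw [rk_sh]
  induction d with
  | zero => simp [macaulayGrow]
  | succ d ih =>
    rw [macaulayGrow, Finset.sum_range_succ, ← ih]
    rcases Nat.eq_zero_or_pos (b d) with h | h
    · have h0 : ∀ k ≤ d, b k = 0 := fun k hk => by have := hb hk; omega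
      have h1 : ∀ e, e ≤ d + 1 → rk e b = 0 := by
        intro e he
        unfold rk
        apply Finset.sum_eq_zero
        intro k hk
        rw [h0 k (by have := Finset.mem_range.1 hk; omega)]
        simp
      rw [if_pos (h1 _ le_rfl), h1 d (by omega), h, grow_zero]
      simp
    · have h1 : rk d b < (b d + d).choose d := rk_lt (fun k hk => hb hk.le)
      have h3 : 0 < (b d + d).choose (d+1) := Nat.choose_pos (by omega)
      have h2 : binomExpTop (rk (d+1) b) (d+1) = b d + d := by
        apply binomExpTop_eq (by omega)
        · rw [rk_succ]; omega
        · rw [rk_succ, Nat.choose_succ_succ']; omega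
      rw [h2, if_neg (by rw [rk_succ]; omega), rk_succ, Nat.add_sub_cancel, add_comm]

lemma grow_mono {d : ℕ} {p q : ℕ} (hpq : p ≤ q) :
    macaulayGrow d p ≤ macaulayGrow d q := by
  rcases Nat.eq_zero_or_pos d with rfl | hd
  · simp [macaulayGrow]
  obtain ⟨b, hb, rfl⟩ := exists_rk hd p
  obtain ⟨u, hu, rfl⟩ := exists_rk hd q
  rw [grow_rk d hb, grow_rk d hu]
  exact rk_sh_le hb hu hpq

/-- growth predicate, with a convention in degree zero -/
def GrowOK (d q p : ℕ) : Prop := if d = 0 then (0 < p → 0 < q) else p ≤ macaulayGrow d q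

lemma rk_split (d : ℕ) (b : ℕ → ℕ) :
    rk (d+1) b = rk d (fun k => b (k+1)) + (if 0 < b 0 then 1 else 0)
      + rk (d+1) (fun k => b k - 1) := by
  have key : ∀ k, (b (k+1) + (k+1)).choose (k+2)
      = (b (k+1) + k).choose (k+1) + (b (k+1) - 1 + (k+1)).choose (k+2) := by
    intro k
    rcases Nat.eq_zero_or_pos (b (k+1)) with h | h
    · simp [h]
    · rw [← add_assoc, Nat.choose_succ_succ']
      congr 2
      omega
  unfold rk
  rw [Finset.sum_range_succ', Finset.sum_range_succ' (n := d)]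
  simp only [add_assoc, Nat.reduceAdd, zero_add, add_zero, Nat.choose_one_right]
  have : ∑ k ∈ Finset.range d, (b (k+1) + (k+1)).choose (k+2)
      = ∑ k ∈ Finset.range d, (b (k+1) + k).choose (k+1)
        + ∑ k ∈ Finset.range d, (b (k+1) - 1 + (k+1)).choose (k+2) := by
    rw [← Finset.sum_add_distrib]
    exact Finset.sum_congr rfl (fun k _ => key k)
  rw [this]
  split_ifs <;> omega

lemma rk_sh_split (d : ℕ) (b : ℕ → ℕ) :
    rk d b + rk (d+1) (sh (fun k => b k - 1)) = rk (d+1) (sh b) := by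
  rw [rk_sh, rk_sh]
  unfold rk
  rw [← Finset.sum_add_distrib]
  apply Finset.sum_congr rfl
  intro k _
  rcases Nat.eq_zero_or_pos (b k) with h | h
  · simp [h]
  · rw [Nat.choose_succ_succ' (b k + k)]
    congr 2
    omega

lemma key_numeric {d p q : ℕ} (h : GrowOK d q p) :
    p + macaulayGrow (d+1) (p - q) ≤ macaulayGrow (d+1) p := by
  obtain ⟨b, hb, rfl⟩ := exists_rk (d := d+1) (by omega) p
  have hb1 : Monotone (fun k => b k - 1) := fun x y hxy => by have := hb hxy; dsimp; omega
  have hq : rk d (fun k => b (k+1)) + (if 0 < b 0 then 1 else 0) ≤ q := by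
    unfold GrowOK at h
    split_ifs at h with hd
    · subst hd
      simp [rk] at h ⊢
      split_ifs <;> omega
    · obtain ⟨u, hu, rfl⟩ := exists_rk (d := d) (by omega) q
      rw [grow_rk d hu] at h
      have hb2 : Monotone (fun k => b (k+1)) := fun x y hxy => hb (by omega)
      have h1 : rk d (fun k => b (k+1)) ≤ rk d u := by
        by_contra hc
        have := rk_sh_lt hu hb (not_le.1 hc)
        omega
      rcases h1.lt_or_eq with h2 | h2
      · split_ifs <;> omega
      · split_ifs with h0
        · exfalso
          have h3 := rk_inj hb2 hu h2
          have := rk_lt_of (d := d+1) (b := sh u) (b' := b) (j := 0) (sh_mono hu) (by omega) (by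
            intro k h4 h5
            obtain ⟨k, rfl⟩ : ∃ k', k = k' + 1 := ⟨k - 1, by omega⟩
            exact (h3 k (by omega)).symm) h0
          omega
        · omega
  have h1 : rk (d+1) b - q ≤ rk (d+1) (fun k => b k - 1) := by
    have := rk_split d b
    omega
  have h2 := grow_mono (d := d+1) h1
  rw [grow_rk _ hb1] at h2
  rw [grow_rk _ hb, ← rk_sh_split]
  omega

/-- strongly stable families of monomials in the variables `≥ s` -/
def StableFrom (s : ℕ) (N : Finset (ℕ →₀ ℕ)) : Prop :=
  ∀ m ∈ N, ∀ i j, s ≤ i → i < j → 0 < m j →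
    m - Finsupp.single j 1 + Finsupp.single i 1 ∈ N

/-- colon by the variable `s` -/
noncomputable def quoVar (s : ℕ) (N : Finset (ℕ →₀ ℕ)) : Finset (ℕ →₀ ℕ) :=
  (N.filter (fun m => 0 < m s)).image (fun m => m - Finsupp.single s 1)

lemma sub_add_single {m : ℕ →₀ ℕ} {s : ℕ} (h : 0 < m s) :
    m - Finsupp.single s 1 + Finsupp.single s 1 = m := by
  ext k
  simp only [Finsupp.coe_add, Finsupp.coe_tsub, Pi.add_apply, Pi.sub_apply, Finsupp.single_apply]
  split_ifs with hk
  · subst hk; omega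
  · omega

lemma mem_quoVar {s : ℕ} {N : Finset (ℕ →₀ ℕ)} {u : ℕ →₀ ℕ} :
    u ∈ quoVar s N ↔ u + Finsupp.single s 1 ∈ N := by
  simp only [quoVar, Finset.mem_image, Finset.mem_filter]
  constructor
  · rintro ⟨m, ⟨hm, hs⟩, rfl⟩
    rwa [sub_add_single hs]
  · intro h
    exact ⟨_, ⟨h, by simp⟩, by simp⟩

lemma card_quoVar (s : ℕ) (N : Finset (ℕ →₀ ℕ)) :
    (quoVar s N).card + (N.filter (fun m => m s = 0)).card = N.card := by
  have h1 : (quoVar s N).card = (N.filter (fun m => 0 < m s)).card := by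
    apply Finset.card_image_of_injOn
    intro m hm m' hm' h
    simp only [Finset.coe_filter, Set.mem_ofPred_eq] at hm hm'
    have h2 : m - Finsupp.single s 1 = m' - Finsupp.single s 1 := h
    rw [← sub_add_single hm.2, h2, sub_add_single hm'.2]
  have h2 := Finset.card_filter_add_card_filter_not (s := N) (fun m => 0 < m s)
  simp only [not_lt, Nat.le_zero] at h2
  rw [h1, h2]

lemma quoVar_nonempty {s d : ℕ} {N : Finset (ℕ →₀ ℕ)} (hst : StableFrom s N)
    (hdeg : ∀ m ∈ N, m.degree = d + 1) (hsupp : ∀ m ∈ N, ∀ k < s, m k = 0)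
    (hN : N.Nonempty) : (quoVar s N).Nonempty := by
  obtain ⟨m, hm⟩ := hN
  by_cases h : 0 < m s
  · exact ⟨m - Finsupp.single s 1, by rw [mem_quoVar, sub_add_single h]; exact hm⟩
  · have : m ≠ 0 := by
      rintro rfl
      have := hdeg _ hm
      simp at this
    obtain ⟨j, hj⟩ := Finsupp.ne_iff.1 this
    simp only [Finsupp.coe_zero, Pi.zero_apply] at hj
    have hjs : s < j := by
      by_contra hc
      rcases Nat.lt_or_ge j s with h1 | h1
      · exact hj (hsupp m hm j h1)
      · have : j = s := by omega
        subst this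
        omega
    exact ⟨m - Finsupp.single j 1, by
      rw [mem_quoVar]; exact hst m hm s j le_rfl hjs (by omega)⟩

lemma stable_quoVar {s : ℕ} {N : Finset (ℕ →₀ ℕ)} (hst : StableFrom s N) :
    StableFrom s (quoVar s N) := by
  intro m hm i j hi hij hj
  rw [mem_quoVar] at hm ⊢
  have := hst _ hm i j hi hij (by simp; omega)
  convert this using 1
  ext k
  simp only [Finsupp.coe_add, Finsupp.coe_tsub, Pi.add_apply, Pi.sub_apply, Finsupp.single_apply]
  split_ifs <;> subst_vars <;> omega

lemma stable_filter {s : ℕ} {N : Finset (ℕ →₀ ℕ)} (hst : StableFrom s N) :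
    StableFrom (s+1) (N.filter (fun m => m s = 0)) := by
  intro m hm i j hi hij hj
  rw [Finset.mem_filter] at hm ⊢
  refine ⟨hst m hm.1 i j (by omega) hij hj, ?_⟩
  simp only [Finsupp.coe_add, Finsupp.coe_tsub, Pi.add_apply, Pi.sub_apply, Finsupp.single_apply]
  have := hm.2
  split_ifs <;> omega

lemma stable_bound (d : ℕ) : ∀ (c s : ℕ) (N : Finset (ℕ →₀ ℕ)), N.card = c →
    StableFrom s N → (∀ m ∈ N, m.degree = d + 1) → (∀ m ∈ N, ∀ k < s, m k = 0) →
    GrowOK d (quoVar s N).card N.card := by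
  induction d with
  | zero =>
    intro c s N _ hst hdeg hsupp
    simp only [GrowOK, if_true]
    intro h
    exact Finset.card_pos.2 (quoVar_nonempty hst hdeg hsupp (Finset.card_pos.1 h))
  | succ d ihd =>
    intro c
    induction c using Nat.strong_induction_on with
    | _ c ihc =>
    intro s N hc hst hdeg hsupp
    simp only [GrowOK, Nat.succ_ne_zero, if_false]
    rcases N.eq_empty_or_nonempty with rfl | hN
    · simp
    have hq := Finset.card_pos.2 (quoVar_nonempty hst hdeg hsupp hN)
    have hcard := card_quoVar s N
    set P := quoVar s N with hP
    set N2 := N.filter (fun m => m s = 0) with hN2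
    have hPdeg : ∀ m ∈ P, m.degree = d + 1 := by
      intro m hm
      have := hdeg _ (mem_quoVar.1 hm)
      simpa using this
    have hPsupp : ∀ m ∈ P, ∀ k < s, m k = 0 := by
      intro m hm k hk
      have := hsupp _ (mem_quoVar.1 hm) k hk
      simp at this
      exact this.1
    have h1 := ihd _ s P rfl (stable_quoVar hst) hPdeg hPsupp
    have h2 := ihc N2.card (by omega) (s+1) N2 rfl (stable_filter hst)
      (fun m hm => hdeg m (Finset.mem_filter.1 hm).1) (by
        intro m hm k hk
        rw [hN2, Finset.mem_filter] at hm
        rcases Nat.lt_or_ge k s with h | h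
        · exact hsupp m hm.1 k h
        · have : k = s := by omega
          rw [this]; exact hm.2)
    simp only [GrowOK, Nat.succ_ne_zero, if_false] at h2
    have h3 : (quoVar (s+1) N2) ⊆ P.filter (fun m => m s = 0) := by
      intro u hu
      rw [mem_quoVar, hN2, Finset.mem_filter] at hu
      rw [Finset.mem_filter, hP, mem_quoVar]
      refine ⟨?_, ?_⟩
      · have := hst _ hu.1 s (s+1) le_rfl (by omega) (by simp)
        simpa using this
      · have := hu.2
        simp at this
        exact this
    have h4 := card_quoVar s P
    have h5 := Finset.card_le_card h3
    have h6 := grow_mono (d := d+1) (show (quoVar (s+1) N2).card ≤ P.card - (quoVar s P).card by omega)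
    have h7 := key_numeric h1
    omega

/-- the point with `j`-exponent `b` on the `(i,j)`-line through `m` -/
noncomputable def lineAt (i j : ℕ) (m : ℕ →₀ ℕ) (b : ℕ) : ℕ →₀ ℕ :=
  (m.erase i).erase j + Finsupp.single j b + Finsupp.single i (m i + m j - b)

lemma lineAt_apply {i j : ℕ} (hij : i < j) (m : ℕ →₀ ℕ) (b k : ℕ) :
    lineAt i j m b k = if k = j then b else if k = i then m i + m j - b else m k := by
  simp only [lineAt, Finsupp.coe_add, Pi.add_apply, Finsupp.single_apply, Finsupp.erase_apply]
  split_ifs <;> subst_vars <;> omega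

lemma lineAt_self {i j : ℕ} (hij : i < j) (m : ℕ →₀ ℕ) : lineAt i j m (m j) = m := by
  ext k
  rw [lineAt_apply hij]
  split_ifs <;> subst_vars <;> omega

lemma lineAt_lineAt {i j : ℕ} (hij : i < j) (m : ℕ →₀ ℕ) {b : ℕ} (hb : b ≤ m i + m j) (b' : ℕ) :
    lineAt i j (lineAt i j m b) b' = lineAt i j m b' := by
  ext k
  simp only [lineAt_apply hij]
  split_ifs <;> subst_vars <;> omega

lemma lineAt_degree {i j : ℕ} (hij : i < j) (m : ℕ →₀ ℕ) {b : ℕ} (hb : b ≤ m i + m j) :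
    (lineAt i j m b).degree = m.degree := by
  conv_rhs => rw [← lineAt_self hij m]
  simp only [lineAt, map_add, Finsupp.degree_single]
  omega

lemma lineAt_weight {i j : ℕ} (hij : i < j) (m : ℕ →₀ ℕ) {b : ℕ} (hb : b ≤ m j) :
    Finsupp.weight id (lineAt i j m b) + (m j - b) * (j - i) = Finsupp.weight id m := by
  conv_rhs => rw [← lineAt_self hij m]
  simp only [lineAt, map_add, Finsupp.weight_single, id, smul_eq_mul]
  obtain ⟨t, ht⟩ := Nat.exists_eq_add_of_le hb
  obtain ⟨e, he⟩ := Nat.exists_eq_add_of_lt hij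
  have h1 : m i + m j - b = m i + t := by omega
  have h2 : m j - b = t := by omega
  have h3 : j - i = e + 1 := by omega
  have h4 : m i + m j - m j = m i := by omega
  rw [h1, h2, h3, h4, ht, he]
  ring

/-- position of `m` in its line -/
noncomputable def linePos (i j : ℕ) (N : Finset (ℕ →₀ ℕ)) (m : ℕ →₀ ℕ) : ℕ :=
  Nat.count (fun b => lineAt i j m b ∈ N) (m j)

/-- number of elements of `N` on the line of `m` -/
noncomputable def lineCnt (i j : ℕ) (N : Finset (ℕ →₀ ℕ)) (m : ℕ →₀ ℕ) : ℕ :=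
  Nat.count (fun b => lineAt i j m b ∈ N) (m i + m j + 1)

/-- compression -/
noncomputable def compress (i j : ℕ) (N : Finset (ℕ →₀ ℕ)) : Finset (ℕ →₀ ℕ) :=
  N.image (fun m => lineAt i j m (linePos i j N m))

lemma linePos_le (i j : ℕ) (N : Finset (ℕ →₀ ℕ)) (m : ℕ →₀ ℕ) : linePos i j N m ≤ m j :=
  Nat.count_le _

lemma compress_injOn {i j : ℕ} (hij : i < j) (N : Finset (ℕ →₀ ℕ)) :
    Set.InjOn (fun m => lineAt i j m (linePos i j N m)) N := by
  intro m hm m' hm' h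
  simp only at h
  have hl := linePos_le i j N m
  have hl' := linePos_le i j N m'
  have h1 : ∀ b, lineAt i j m b = lineAt i j m' b := by
    intro b
    rw [← lineAt_lineAt hij m (b := linePos i j N m) (by omega), h,
      lineAt_lineAt hij m' (by omega)]
  have h2 : linePos i j N m = linePos i j N m' := by
    have := DFunLike.congr_fun h j
    simpa [lineAt_apply hij] using this
  have h3 : m j = m' j := by
    unfold linePos at h2
    simp only [h1] at h2
    by_contra hne
    have e1 : lineAt i j m' (m j) ∈ N := by rw [← h1, lineAt_self hij]; exact hm
    have e2 : lineAt i j m' (m' j) ∈ N := by rw [lineAt_self hij]; exact hm'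
    rcases lt_or_gt_of_ne hne with hlt | hlt
    · have := Nat.count_strict_mono (p := fun b => lineAt i j m' b ∈ N) e1 hlt
      omega
    · have := Nat.count_strict_mono (p := fun b => lineAt i j m' b ∈ N) e2 hlt
      omega
  rw [← lineAt_self hij m, h1, h3, lineAt_self hij]

lemma card_compress {i j : ℕ} (hij : i < j) (N : Finset (ℕ →₀ ℕ)) :
    (compress i j N).card = N.card := Finset.card_image_of_injOn (compress_injOn hij N)

lemma exists_count (p : ℕ → Prop) [DecidablePred p] (n t : ℕ) (h : t < Nat.count p n) :
    ∃ b < n, p b ∧ Nat.count p b = t := by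
  induction n with
  | zero => simp at h
  | succ n ih =>
    rcases Nat.lt_or_ge t (Nat.count p n) with h1 | h1
    · obtain ⟨b, hb, h2⟩ := ih h1
      exact ⟨b, by omega, h2⟩
    · rw [Nat.count_succ] at h
      split_ifs at h with hp
      · exact ⟨n, by omega, hp, by omega⟩
      · omega

lemma mem_compress {i j : ℕ} (hij : i < j) {N : Finset (ℕ →₀ ℕ)} {y : ℕ →₀ ℕ} :
    y ∈ compress i j N ↔ y j < lineCnt i j N y := by
  simp only [compress, Finset.mem_image]
  constructor
  · rintro ⟨m, hm, rfl⟩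
    have hl := linePos_le i j N m
    have hb : linePos i j N m ≤ m i + m j := by omega
    unfold lineCnt
    simp only [lineAt_lineAt hij m hb]
    have e : lineAt i j m (linePos i j N m) i + lineAt i j m (linePos i j N m) j = m i + m j := by
      simp only [lineAt_apply hij]
      rw [if_neg (by omega)]
      simp
      omega
    rw [e]
    have e2 : lineAt i j m (linePos i j N m) j = linePos i j N m := by simp [lineAt_apply hij]
    rw [e2]
    exact Nat.count_strict_mono (p := fun b => lineAt i j m b ∈ N)
      (by rw [lineAt_self hij]; exact hm) (by omega)
  · intro h
    obtain ⟨b, hb, h1, h2⟩ := exists_count _ _ _ h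
    refine ⟨_, h1, ?_⟩
    unfold linePos
    have e2 : lineAt i j y b j = b := by simp [lineAt_apply hij]
    simp only [lineAt_lineAt hij y (show b ≤ y i + y j by omega), e2, h2]
    exact lineAt_self hij y

lemma count_shadow (P Q : ℕ → Prop) [DecidablePred P] [DecidablePred Q] (s t : ℕ)
    (h1 : ∀ b < s, P b → Q b) (h2 : ∀ b < s, P (b+1) → Q b)
    (ht : t < Nat.count P (s+1)) (hts : t < s) : t < Nat.count Q s := by
  have mono : ∀ b ≤ s, Nat.count P b ≤ Nat.count Q b := by
    intro b
    induction b with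
    | zero => simp
    | succ b ih =>
      intro hb
      have := ih (by omega)
      have := h1 b (by omega)
      rw [Nat.count_succ, Nat.count_succ]
      split_ifs <;> first | omega | tauto
  by_cases hall : ∀ b < s, P b
  · have : ∀ b ≤ s, Nat.count Q b = b := by
      intro b
      induction b with
      | zero => simp
      | succ b ih =>
        intro hb
        rw [Nat.count_succ, ih (by omega), if_pos (h1 b (by omega) (hall b (by omega)))]
    rw [this s le_rfl]
    exact hts
  · push Not at hall
    obtain ⟨b0, hb0, hP⟩ := hall
    have : ∀ c, b0 + c ≤ s → Nat.count P (b0 + c + 1) ≤ Nat.count Q (b0 + c) := by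
      intro c
      induction c with
      | zero =>
        intro _
        rw [add_zero, Nat.count_succ, if_neg hP]
        exact mono b0 hb0.le
      | succ c ih =>
        intro hc
        have e1 := ih (by omega)
        have e2 := h2 (b0 + c) (by omega)
        rw [Nat.count_succ, ← add_assoc, Nat.count_succ (p := Q)]
        split_ifs <;> first | omega | tauto
    have := this (s - b0) (by omega)
    rw [show b0 + (s - b0) = s by omega] at this
    omega

/-- the shadow of `N` lies in `M` -/
def ShadowIn (N M : Finset (ℕ →₀ ℕ)) : Prop :=
  ∀ m ∈ N, ∀ k, 0 < m k → m - Finsupp.single k 1 ∈ M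

lemma shadow_compress {i j : ℕ} (hij : i < j) {N M : Finset (ℕ →₀ ℕ)} (h : ShadowIn N M) :
    ShadowIn (compress i j N) (compress i j M) := by
  intro x hx k hk
  rw [mem_compress hij] at hx ⊢
  set y := x - Finsupp.single k 1 with hy
  have hya : ∀ l, y l = x l - if k = l then 1 else 0 := by
    intro l
    simp [hy, Finsupp.single_apply]
  by_cases hkij : k = i ∨ k = j
  · have hs : y i + y j + 1 = x i + x j := by
      rw [hya, hya]
      rcases hkij with rfl | rfl
      · rw [if_pos rfl, if_neg (by omega)]; omega
      · rw [if_pos rfl, if_neg (by omega)]; omega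
    unfold lineCnt at hx ⊢
    rw [hs]
    have hyj : y j ≤ x j := by rw [hya]; omega
    apply count_shadow (fun b => lineAt i j x b ∈ N) _ (x i + x j)
    · intro b hb hP
      have := h _ hP i (by rw [lineAt_apply hij, if_neg (by omega), if_pos rfl]; omega)
      convert this using 1
      ext l
      simp only [lineAt_apply hij, Finsupp.coe_tsub, Pi.sub_apply, Finsupp.single_apply]
      have := hya l
      split_ifs at * <;> subst_vars <;> omega
    · intro b hb hP
      have := h _ hP j (by rw [lineAt_apply hij, if_pos rfl]; omega)
      convert this using 1
      ext l
      simp only [lineAt_apply hij, Finsupp.coe_tsub, Pi.sub_apply, Finsupp.single_apply]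
      have := hya l
      split_ifs at * <;> subst_vars <;> omega
    · omega
    · omega
  · push Not at hkij
    have hyi : y i = x i := by rw [hya, if_neg hkij.1]; omega
    have hyj : y j = x j := by rw [hya, if_neg hkij.2]; omega
    unfold lineCnt at hx ⊢
    rw [hyi, hyj]
    refine lt_of_lt_of_le hx (Nat.count_mono_left ?_)
    intro b _ hP
    have := h _ hP k (by rw [lineAt_apply hij, if_neg hkij.2, if_neg hkij.1]; omega)
    convert this using 1
    ext l
    simp only [lineAt_apply hij, Finsupp.coe_tsub, Pi.sub_apply, Finsupp.single_apply]
    have := hya l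
    split_ifs at * <;> subst_vars <;> omega

lemma exists_stable (d : ℕ) : ∀ (w : ℕ) (N M : Finset (ℕ →₀ ℕ)),
    ∑ m ∈ N, Finsupp.weight id m = w → (∀ m ∈ N, m.degree = d) → ShadowIn N M →
    ∃ N' M' : Finset (ℕ →₀ ℕ), N'.card = N.card ∧ M'.card = M.card ∧
      (∀ m ∈ N', m.degree = d) ∧ ShadowIn N' M' ∧ StableFrom 0 N' := by
  intro w
  induction w using Nat.strong_induction_on with
  | _ w ih =>
  intro N M hw hdeg hsh
  by_cases hst : StableFrom 0 N
  · exact ⟨N, M, rfl, rfl, hdeg, hsh, hst⟩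
  · unfold StableFrom at hst
    push Not at hst
    obtain ⟨m, hm, i, j, -, hij, hj, hn⟩ := hst
    have hlt : ∑ m ∈ compress i j N, Finsupp.weight id m < w := by
      rw [← hw, compress, Finset.sum_image (compress_injOn hij N)]
      apply Finset.sum_lt_sum
      · intro m' _
        have := lineAt_weight hij m' (linePos_le i j N m')
        omega
      · refine ⟨m, hm, ?_⟩
        have h1 := lineAt_weight hij m (linePos_le i j N m)
        have h2 : linePos i j N m < m j := by
          unfold linePos
          obtain ⟨t, ht⟩ : ∃ t, m j = t + 1 := ⟨m j - 1, by omega⟩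
          rw [ht, Nat.count_succ, if_neg]
          · have := Nat.count_le (fun b => lineAt i j m b ∈ N) (n := t)
            omega
          · intro hc
            apply hn
            convert hc using 1
            ext l
            simp only [lineAt_apply hij, Finsupp.coe_add, Pi.add_apply, Finsupp.coe_tsub,
              Pi.sub_apply, Finsupp.single_apply]
            split_ifs <;> subst_vars <;> omega
        have h3 : 0 < (m j - linePos i j N m) * (j - i) :=
          Nat.mul_pos (by omega) (by omega)
        omega
    obtain ⟨N', M', h1, h2, h3, h4, h5⟩ := ih _ hlt (compress i j N) (compress i j M) rfl (by
      intro y hy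
      simp only [compress, Finset.mem_image] at hy
      obtain ⟨m', hm', rfl⟩ := hy
      have := linePos_le i j N m'
      rw [lineAt_degree hij m' (by omega), hdeg m' hm']) (shadow_compress hij hsh)
    exact ⟨N', M', by rw [h1, card_compress hij], by rw [h2, card_compress hij], h3, h4, h5⟩

lemma macaulay_bound {d : ℕ} (hd : 1 ≤ d) {N M : Finset (ℕ →₀ ℕ)}
    (hdeg : ∀ m ∈ N, m.degree = d + 1) (hsh : ShadowIn N M) :
    N.card ≤ macaulayGrow d M.card := by
  obtain ⟨N', M', h1, h2, h3, h4, h5⟩ := exists_stable (d+1) _ N M rfl hdeg hsh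
  have h6 := stable_bound d _ 0 N' rfl h5 h3 (by simp)
  simp only [GrowOK, show d ≠ 0 by omega, if_false] at h6
  rw [← h1, ← h2]
  refine h6.trans (grow_mono (Finset.card_le_card ?_))
  intro u hu
  rw [mem_quoVar] at hu
  have := h4 _ hu 0 (by simp)
  simpa using this

open Classical in
/-- indices whose vector is not in the span of the previous ones -/
noncomputable def stdPart {k V ι : Type*} [Field k] [AddCommGroup V] [Module k V] [LinearOrder ι]
    (v : ι → V) (U : Finset ι) : Finset ι :=
  U.filter (fun m => v m ∉ Submodule.span k (v '' {m' | m' ∈ U ∧ m' < m}))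

lemma stdPart_spec {k V ι : Type*} [Field k] [AddCommGroup V] [Module k V] [LinearOrder ι]
    (v : ι → V) (U : Finset ι) :
    Submodule.span k (v '' (stdPart (k := k) v U : Set ι)) = Submodule.span k (v '' (U : Set ι)) ∧
      LinearIndepOn k v (stdPart (k := k) v U : Set ι) := by
  classical
  induction U using Finset.induction_on_max with
  | empty => simp [stdPart]
  | insert a U ha ih =>
    obtain ⟨ih1, ih2⟩ := ih
    have haU : a ∉ U := fun h => lt_irrefl _ (ha a h)
    have hset : {m' | m' ∈ insert a U ∧ m' < a} = (U : Set ι) := by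
      ext x
      simp only [Finset.mem_insert, Set.mem_ofPred_eq, Finset.mem_coe]
      constructor
      · rintro ⟨rfl | h, h2⟩
        · exact absurd h2 (lt_irrefl _)
        · exact h
      · intro h
        exact ⟨Or.inr h, ha x h⟩
    have hmem : ∀ m ∈ U, m ∈ stdPart (k := k) v (insert a U) ↔ m ∈ stdPart (k := k) v U := by
      intro m hm
      have : {m' | m' ∈ insert a U ∧ m' < m} = {m' | m' ∈ U ∧ m' < m} := by
        ext x
        simp only [Finset.mem_insert, Set.mem_ofPred_eq]
        constructor
        · rintro ⟨rfl | h, h2⟩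
          · exact absurd (h2.trans (ha m hm)) (lt_irrefl _)
          · exact ⟨h, h2⟩
        · rintro ⟨h, h2⟩
          exact ⟨Or.inr h, h2⟩
      rw [stdPart, stdPart, Finset.mem_filter, Finset.mem_filter, this]
      simp only [hm, Finset.mem_insert, or_true, true_and]
    have hsub : ∀ m, m ∈ stdPart (k := k) v U → m ∈ U := fun m hm => (Finset.mem_filter.1 hm).1
    by_cases hv : v a ∈ Submodule.span k (v '' (U : Set ι))
    · have : stdPart (k := k) v (insert a U) = stdPart (k := k) v U := by
        ext m
        by_cases hm : m ∈ U
        · exact hmem m hm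
        · constructor
          · intro h
            have h1 := Finset.mem_filter.1 h
            rcases Finset.mem_insert.1 h1.1 with rfl | h2
            · exfalso
              apply h1.2
              rw [hset]
              exact hv
            · exact absurd h2 hm
          · intro h
            exact absurd (hsub m h) hm
      rw [this]
      refine ⟨?_, ih2⟩
      rw [ih1, Finset.coe_insert, Set.image_insert_eq, Submodule.span_insert_eq_span hv]
    · have : stdPart (k := k) v (insert a U) = insert a (stdPart (k := k) v U) := by
        ext m
        rw [Finset.mem_insert]
        by_cases hm : m ∈ U
        · rw [hmem m hm]
          constructor
          · exact Or.inr
          · rintro (rfl | h)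
            · exact absurd hm haU
            · exact h
        · constructor
          · intro h
            have h1 := Finset.mem_filter.1 h
            rcases Finset.mem_insert.1 h1.1 with rfl | h2
            · exact Or.inl rfl
            · exact absurd h2 hm
          · rintro (rfl | h)
            · refine Finset.mem_filter.2 ⟨Finset.mem_insert_self _ _, ?_⟩
              rw [hset]
              exact hv
            · exact absurd (hsub m h) hm
      rw [this, Finset.coe_insert, Finset.coe_insert, Set.image_insert_eq, Set.image_insert_eq]
      refine ⟨?_, ?_⟩
      · rw [Submodule.span_insert, Submodule.span_insert, ih1]
      · exact ih2.insert (by rw [ih1]; exact hv)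

lemma finrank_of_indep {k V ι : Type*} [Field k] [AddCommGroup V] [Module k V]
    {v : ι → V} {T : Finset ι} (h : LinearIndepOn k v (T : Set ι)) :
    Module.finrank k (Submodule.span k (v '' (T : Set ι))) = T.card := by
  have := finrank_span_eq_card (R := k) (b := fun x : (T : Set ι) => v x) h
  rw [← Set.image_eq_range] at this
  rw [this]
  simp

/-- class of a monomial in the quotient -/
noncomputable def monCls {k : Type*} [Field k] {n : ℕ} (I : Ideal (MvPolynomial (Fin n) k))
    (m : Fin n →₀ ℕ) : MvPolynomial (Fin n) k ⧸ I :=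
  Ideal.Quotient.mkₐ k I (monomial m 1)

lemma quotPiece_eq_span {k : Type*} [Field k] {n : ℕ} (I : Ideal (MvPolynomial (Fin n) k)) (d : ℕ) :
    quotPiece I d = Submodule.span k (monCls I '' {m | m.degree = d}) := by
  have h : homogeneousSubmodule (Fin n) k d
      = Submodule.span k ((fun m => monomial m (1:k)) '' {m | m.degree = d}) := by
    apply le_antisymm
    · intro p hp
      rw [mem_homogeneousSubmodule] at hp
      rw [← support_sum_monomial_coeff p]
      apply Submodule.sum_mem
      intro m hm
      have h1 : monomial m (coeff m p) = (coeff m p) • monomial m (1:k) := by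
        rw [smul_monomial, smul_eq_mul, mul_one]
      rw [h1]
      apply Submodule.smul_mem
      apply Submodule.subset_span
      refine ⟨m, ?_, rfl⟩
      have := hp (mem_support_iff.1 hm)
      change m.degree = d
      rw [Finsupp.degree_eq_weight_one]
      exact this
    · rw [Submodule.span_le]
      rintro _ ⟨m, hm, rfl⟩
      exact isHomogeneous_monomial _ hm
  rw [quotPiece, h, Submodule.map_span, ← Set.image_comp]
  rfl

/-- all monomials of degree `d` -/
noncomputable def degMon (n d : ℕ) : Finset (Lex (Fin n →₀ ℕ)) :=
  (Finsupp.finite_of_degree_eq (σ := Fin n) d).toFinset.map toLex.toEmbedding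

lemma mem_degMon {n d : ℕ} {m : Lex (Fin n →₀ ℕ)} : m ∈ degMon n d ↔ (ofLex m).degree = d := by
  simp only [degMon, Finset.mem_map, Set.Finite.mem_toFinset, Set.mem_ofPred_eq]
  constructor
  · rintro ⟨x, hx, rfl⟩
    exact hx
  · intro h
    exact ⟨ofLex m, h, rfl⟩

/-- standard monomials -/
noncomputable def stdMon {k : Type*} [Field k] {n : ℕ} (I : Ideal (MvPolynomial (Fin n) k)) (d : ℕ) :
    Finset (Lex (Fin n →₀ ℕ)) :=
  stdPart (k := k) (fun m => monCls I (ofLex m)) (degMon n d)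

lemma mem_stdMon {k : Type*} [Field k] {n : ℕ} {I : Ideal (MvPolynomial (Fin n) k)} {d : ℕ}
    {m : Lex (Fin n →₀ ℕ)} : m ∈ stdMon I d ↔ (ofLex m).degree = d ∧
      monCls I (ofLex m) ∉ Submodule.span k ((fun m => monCls I (ofLex m)) ''
        {m' | m' ∈ degMon n d ∧ m' < m}) := by
  simp only [stdMon, stdPart, Finset.mem_filter, mem_degMon]

lemma hilbertFn_eq_card {k : Type*} [Field k] {n : ℕ} (I : Ideal (MvPolynomial (Fin n) k)) (d : ℕ) :
    hilbertFn I d = (stdMon I d).card := by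
  obtain ⟨h1, h2⟩ := stdPart_spec (k := k) (fun m : Lex (Fin n →₀ ℕ) => monCls I (ofLex m))
    (degMon n d)
  have h3 := finrank_of_indep h2
  rw [h1] at h3
  rw [stdMon, ← h3, hilbertFn, quotPiece_eq_span]
  have : monCls I '' {m | m.degree = d}
      = (fun m : Lex (Fin n →₀ ℕ) => monCls I (ofLex m)) '' (degMon n d : Set _) := by
    ext x
    constructor
    · rintro ⟨m, hm, rfl⟩
      exact ⟨toLex m, mem_degMon.2 hm, rfl⟩
    · rintro ⟨m, hm, rfl⟩
      exact ⟨ofLex m, mem_degMon.1 hm, rfl⟩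
  rw [this]

lemma monCls_add {k : Type*} [Field k] {n : ℕ} (I : Ideal (MvPolynomial (Fin n) k))
    (m m' : Fin n →₀ ℕ) : monCls I m' * monCls I m = monCls I (m + m') := by
  unfold monCls
  rw [← map_mul, monomial_mul, one_mul, add_comm]

lemma stdMon_shadow {k : Type*} [Field k] {n : ℕ} {I : Ideal (MvPolynomial (Fin n) k)} {d : ℕ}
    {m : Fin n →₀ ℕ} {j : Fin n} (h : toLex (m + Finsupp.single j 1) ∈ stdMon I (d+1)) :
    toLex m ∈ stdMon I d := by
  rw [mem_stdMon] at h ⊢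
  obtain ⟨h1, h2⟩ := h
  refine ⟨by simpa using h1, fun hc => h2 ?_⟩
  have h3 := Submodule.mem_map_of_mem (f := LinearMap.mulLeft k (monCls I (Finsupp.single j 1))) hc
  rw [Submodule.map_span, LinearMap.mulLeft_apply] at h3
  simp only [ofLex_toLex] at h3 ⊢
  rw [monCls_add] at h3
  refine Submodule.span_mono ?_ h3
  rintro _ ⟨_, ⟨m', ⟨hm1, hm2⟩, rfl⟩, rfl⟩
  refine ⟨m' + toLex (Finsupp.single j 1), ⟨?_, ?_⟩, ?_⟩
  · rw [mem_degMon] at hm1 ⊢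
    rw [ofLex_add]
    simp [hm1]
  · rw [toLex_add]
    exact add_lt_add_left hm2 _
  · simp only [LinearMap.mulLeft_apply, monCls_add, ofLex_add, ofLex_toLex]

lemma hilbert_isOSequence {k : Type*} [Field k] {n : ℕ} (I : Ideal (MvPolynomial (Fin n) k))
    (hI : I ≠ ⊤) : IsOSequence (hilbertFn I) := by
  constructor
  · rw [hilbertFn_eq_card, Finset.card_eq_one]
    refine ⟨0, ?_⟩
    ext m
    rw [mem_stdMon, Finset.mem_singleton]
    constructor
    · intro h
      have := (Finsupp.degree_eq_zero_iff _).1 h.1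
      rw [← toLex_ofLex m, this]
      rfl
    · rintro rfl
      refine ⟨by simp, ?_⟩
      have : {m' : Lex (Fin n →₀ ℕ) | m' ∈ degMon n 0 ∧ m' < 0} = ∅ := by
        ext x
        simp only [Set.mem_ofPred_eq, Set.mem_empty_iff_false, iff_false, mem_degMon]
        rintro ⟨h1, h2⟩
        have := (Finsupp.degree_eq_zero_iff _).1 h1
        rw [← toLex_ofLex x, this] at h2
        exact lt_irrefl _ h2
      rw [this]
      simp only [Set.image_empty, Submodule.span_empty, Submodule.mem_bot]
      unfold monCls
      simp only [ofLex_zero]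
      intro h
      apply hI
      rw [Ideal.eq_top_iff_one]
      exact Ideal.Quotient.eq_zero_iff_mem.1 h
  · intro d hd
    rw [hilbertFn_eq_card, hilbertFn_eq_card]
    set f : Lex (Fin n →₀ ℕ) → (ℕ →₀ ℕ) := fun m => Finsupp.mapDomain Fin.val (ofLex m) with hf
    have hinj : Function.Injective f := fun x y h =>
      ofLex.injective (Finsupp.mapDomain_injective Fin.val_injective h)
    rw [← Finset.card_image_of_injective _ hinj, ← Finset.card_image_of_injective (stdMon I d) hinj]
    apply macaulay_bound hd
    · intro m hm
      obtain ⟨m', h1, rfl⟩ := Finset.mem_image.1 hm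
      rw [hf]
      simp only [Finsupp.degree_mapDomain]
      exact (mem_stdMon.1 h1).1
    · intro m hm l hl
      obtain ⟨m', h1, rfl⟩ := Finset.mem_image.1 hm
      have hl2 : l ∈ Set.range (Fin.val : Fin n → ℕ) := by
        by_contra hc
        have := Finsupp.mapDomain_of_notMem_range (f := Fin.val) (ofLex m') l hc
        rw [hf] at hl
        simp only at hl
        omega
      obtain ⟨j, rfl⟩ := hl2
      have hl3 : 0 < ofLex m' j := by
        rw [hf] at hl
        simp only [Finsupp.mapDomain_apply Fin.val_injective] at hl
        exact hl
      obtain ⟨u, hu⟩ : ∃ u, ofLex m' = u + Finsupp.single j 1 := by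
        refine ⟨ofLex m' - Finsupp.single j 1, ?_⟩
        rw [tsub_add_cancel_of_le]
        rw [Finsupp.single_le_iff]
        omega
      rw [← toLex_ofLex m', hu] at h1
      refine Finset.mem_image.2 ⟨toLex u, stdMon_shadow h1, ?_⟩
      simp only [hf, hu, Finsupp.mapDomain_add, Finsupp.mapDomain_single, ofLex_toLex]
      rw [add_tsub_cancel_right]

/-- monomial attached to a sequence of indices -/
noncomputable def monSeq (d : ℕ) (b : ℕ → ℕ) : ℕ →₀ ℕ :=
  ∑ k ∈ Finset.range d, Finsupp.single (b k) 1

lemma monSeq_succ (d : ℕ) (b : ℕ → ℕ) :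
    monSeq (d+1) b = monSeq d b + Finsupp.single (b d) 1 := by
  simp [monSeq, Finset.sum_range_succ]

lemma monSeq_degree (d : ℕ) (b : ℕ → ℕ) : (monSeq d b).degree = d := by
  simp [monSeq, map_sum]

lemma monSeq_congr {d : ℕ} {b b' : ℕ → ℕ} (h : ∀ k < d, b k = b' k) : monSeq d b = monSeq d b' := by
  unfold monSeq
  apply Finset.sum_congr rfl
  intro k hk
  rw [h k (Finset.mem_range.1 hk)]

lemma monSeq_pos {d : ℕ} {b : ℕ → ℕ} {l : ℕ} : 0 < monSeq d b l ↔ ∃ j < d, b j = l := by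
  induction d with
  | zero => simp [monSeq]
  | succ d ih =>
    rw [monSeq_succ, Finsupp.add_apply, Finsupp.single_apply]
    constructor
    · intro h
      split_ifs at h with h1
      · exact ⟨d, by omega, h1⟩
      · obtain ⟨j, hj, h2⟩ := ih.1 (by omega)
        exact ⟨j, by omega, h2⟩
    · rintro ⟨j, hj, h2⟩
      rcases Nat.lt_succ_iff_lt_or_eq.1 hj with h3 | rfl
      · have := ih.2 ⟨j, h3, h2⟩
        omega
      · rw [if_pos h2]; omega

lemma monSeq_inj {d : ℕ} {b b' : ℕ → ℕ} (hb : Monotone b) (hb' : Monotone b')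
    (h : monSeq d b = monSeq d b') : ∀ k < d, b k = b' k := by
  induction d with
  | zero => intro k hk; omega
  | succ d ih =>
    have h1 : b d = b' d := by
      apply le_antisymm
      · have h2 : 0 < monSeq (d+1) b' (b d) := by rw [← h]; exact monSeq_pos.2 ⟨d, by omega, rfl⟩
        obtain ⟨j, hj, h3⟩ := monSeq_pos.1 h2
        rw [← h3]
        exact hb' (by omega)
      · have h2 : 0 < monSeq (d+1) b (b' d) := by rw [h]; exact monSeq_pos.2 ⟨d, by omega, rfl⟩
        obtain ⟨j, hj, h3⟩ := monSeq_pos.1 h2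
        rw [← h3]
        exact hb (by omega)
    rw [monSeq_succ, monSeq_succ, h1] at h
    have h2 := ih (add_right_cancel h)
    intro k hk
    rcases Nat.lt_succ_iff_lt_or_eq.1 hk with h3 | rfl
    · exact h2 k h3
    · exact h1

/-- remove index `j` -/
def dropIdx (j : ℕ) (b : ℕ → ℕ) : ℕ → ℕ := fun t => if t < j then b t else b (t+1)

lemma dropIdx_mono {j : ℕ} {b : ℕ → ℕ} (hb : Monotone b) : Monotone (dropIdx j b) := by
  intro x y hxy
  unfold dropIdx
  split_ifs
  · exact hb hxy
  · exact hb (by omega)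
  · omega
  · exact hb (by omega)

lemma monSeq_dropIdx {d j : ℕ} (b : ℕ → ℕ) (hj : j ≤ d) :
    monSeq (d+1) b = monSeq d (dropIdx j b) + Finsupp.single (b j) 1 := by
  induction d with
  | zero =>
    have : j = 0 := by omega
    subst this
    simp [monSeq]
  | succ d ih =>
    rcases Nat.lt_or_ge d j with h | h
    · have : j = d + 1 := by omega
      subst this
      rw [monSeq_succ]
      congr 1
      exact monSeq_congr (fun k hk => by simp [dropIdx, hk])
    · rw [monSeq_succ, ih h, monSeq_succ]
      have : dropIdx j b d = b (d+1) := by simp [dropIdx, h]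
      rw [this]
      abel

/-- the order ideal of monomials attached to a sequence -/
def StdSeq (a : ℕ → ℕ) (m : ℕ →₀ ℕ) : Prop :=
  ∃ b : ℕ → ℕ, Monotone b ∧ monSeq m.degree b = m ∧ rk m.degree b < a m.degree

lemma stdSeq_step {a : ℕ → ℕ} (ha : IsOSequence a) {m : ℕ →₀ ℕ} {l : ℕ}
    (h : StdSeq a (m + Finsupp.single l 1)) : StdSeq a m := by
  obtain ⟨b, hb, h1, h2⟩ := h
  have hdeg : (m + Finsupp.single l 1).degree = m.degree + 1 := by simp
  rw [hdeg] at h1 h2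
  set d := m.degree with hd
  obtain ⟨j, hj, hjl⟩ : ∃ j < d + 1, b j = l := by
    apply monSeq_pos.1
    rw [h1]
    simp
  rw [monSeq_dropIdx b (show j ≤ d by omega), hjl] at h1
  refine ⟨dropIdx j b, dropIdx_mono hb, ?_, ?_⟩
  · rw [← hd]; exact add_right_cancel h1
  · rw [← hd]
    rcases Nat.eq_zero_or_pos d with h0 | h0
    · rw [h0, rk_zero, ha.1]; omega
    · have h3 : rk d (dropIdx j b) ≤ rk d (fun k => b (k+1)) := by
        apply rk_le
        intro k _
        unfold dropIdx
        split_ifs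
        · exact hb (by omega)
        · exact le_rfl
      have hb2 : Monotone (fun k => b (k+1)) := fun x y hxy => hb (by omega)
      refine lt_of_le_of_lt h3 ?_
      by_contra hc
      obtain ⟨u, hu, h4⟩ := exists_rk h0 (a d)
      have h5 := ha.2 d h0
      rw [← h4] at hc h5
      rw [grow_rk d hu] at h5
      have h6 := rk_sh_le hu hb2 (not_lt.1 hc)
      have h7 : rk (d+1) (sh (fun k => b (k+1))) ≤ rk (d+1) b := by
        apply rk_le
        intro k _
        cases k with
        | zero => simp [sh]
        | succ k => simp [sh]
      omega

lemma stdSeq_down {a : ℕ → ℕ} (ha : IsOSequence a) (e : ℕ) : ∀ (m t : ℕ →₀ ℕ), t.degree = e →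
    StdSeq a (m + t) → StdSeq a m := by
  induction e with
  | zero =>
    intro m t ht h
    rw [(Finsupp.degree_eq_zero_iff _).1 ht, add_zero] at h
    exact h
  | succ e ih =>
    intro m t ht h
    have : t ≠ 0 := by
      rintro rfl
      simp at ht
    obtain ⟨j, hj⟩ := Finsupp.ne_iff.1 this
    simp only [Finsupp.coe_zero, Pi.zero_apply] at hj
    rw [← sub_add_single (Nat.pos_of_ne_zero hj)] at h ht
    rw [← add_assoc] at h
    exact ih m _ (by simpa using ht) (stdSeq_step ha h)

/-- embed monomials -/
noncomputable def embMon {n : ℕ} (m : Fin n →₀ ℕ) : ℕ →₀ ℕ := Finsupp.mapDomain Fin.val m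

lemma embMon_inj {n : ℕ} : Function.Injective (embMon (n := n)) :=
  Finsupp.mapDomain_injective Fin.val_injective

lemma embMon_degree {n : ℕ} (m : Fin n →₀ ℕ) : (embMon m).degree = m.degree :=
  Finsupp.degree_mapDomain _ _

lemma exists_embMon {n : ℕ} (x : ℕ →₀ ℕ) (h : ∀ l, 0 < x l → l < n) :
    ∃ m : Fin n →₀ ℕ, embMon m = x := by
  refine ⟨_, (Finsupp.embDomain_eq_mapDomain Fin.valEmbedding _).symm.trans
    (Finsupp.embDomain_comapDomain (f := Fin.valEmbedding) (g := x) ?_)⟩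
  intro l hl
  have := h l (Nat.pos_of_ne_zero (Finsupp.mem_support_iff.1 hl))
  exact ⟨⟨l, this⟩, rfl⟩

lemma stdSeq_var_lt {a : ℕ → ℕ} (ha : IsOSequence a) {x : ℕ →₀ ℕ} (hx : StdSeq a x) {l : ℕ}
    (hl : 0 < x l) : l < a 1 := by
  have h1 : StdSeq a (Finsupp.single l 1) := by
    rw [← sub_add_single hl, add_comm] at hx
    exact stdSeq_down ha _ _ _ rfl hx
  obtain ⟨b, hb, h2, h3⟩ := h1
  rw [Finsupp.degree_single] at h2 h3
  have h4 : 0 < monSeq 1 b l := by rw [h2]; simp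
  obtain ⟨j, hj, h5⟩ := monSeq_pos.1 h4
  have : j = 0 := by omega
  subst this
  rw [← h5]
  simpa [rk] using h3

open Classical in
lemma card_stdSeq {a : ℕ → ℕ} (ha : IsOSequence a) {n : ℕ} (hn : a 1 ≤ n) (d : ℕ)
    (T : Finset (Fin n →₀ ℕ)) (hT : ∀ m, m ∈ T ↔ m.degree = d ∧ StdSeq a (embMon m)) :
    T.card = a d := by
  have hB : ∀ m : Fin n →₀ ℕ, ∃ b : ℕ → ℕ, m ∈ T →
      Monotone b ∧ monSeq d b = embMon m ∧ rk d b < a d := by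
    intro m
    by_cases hm : m ∈ T
    · have h := (hT m).1 hm
      obtain ⟨b, hb⟩ := h.2
      rw [embMon_degree, h.1] at hb
      exact ⟨b, fun _ => hb⟩
    · exact ⟨fun _ => 0, fun h => absurd h hm⟩
  choose B hB using hB
  rw [← Finset.card_range (a d)]
  apply Finset.card_bij (fun m _ => rk d (B m))
  · intro m hm
    exact Finset.mem_range.2 (hB m hm).2.2
  · intro m hm m' hm' h
    have := rk_inj (hB m hm).1 (hB m' hm').1 h
    apply embMon_inj
    rw [← (hB m hm).2.1, ← (hB m' hm').2.1]
    exact monSeq_congr this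
  · intro t ht
    rw [Finset.mem_range] at ht
    obtain ⟨b, hb, h1⟩ : ∃ b : ℕ → ℕ, Monotone b ∧ rk d b = t := by
      rcases Nat.eq_zero_or_pos d with rfl | hd
      · rw [ha.1] at ht
        exact ⟨fun _ => 0, monotone_const, by rw [rk_zero]; omega⟩
      · exact exists_rk hd t
    have h2 : StdSeq a (monSeq d b) := ⟨b, hb, by rw [monSeq_degree], by
      rw [monSeq_degree, h1]; exact ht⟩
    obtain ⟨m, hm⟩ := exists_embMon (n := n) (monSeq d b) (fun l hl =>
      (stdSeq_var_lt ha h2 hl).trans_le hn)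
    have hmT : m ∈ T := by
      rw [hT, hm, ← embMon_degree, hm, monSeq_degree]
      exact ⟨rfl, h2⟩
    refine ⟨m, hmT, ?_⟩
    have h3 := (hB m hmT)
    rw [← h1]
    exact rk_congr (monSeq_inj h3.1 hb (by rw [h3.2.1, hm]))

/-- the monomial ideal -/
noncomputable def seqIdeal (a : ℕ → ℕ) (n : ℕ) : Ideal (MvPolynomial (Fin n) ℚ) :=
  Ideal.span ((fun s => monomial s (1 : ℚ)) '' {m | ¬ StdSeq a (embMon m)})

lemma mem_seqIdeal {a : ℕ → ℕ} (ha : IsOSequence a) {n : ℕ} {f : MvPolynomial (Fin n) ℚ} :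
    f ∈ seqIdeal a n ↔ ∀ m ∈ f.support, ¬ StdSeq a (embMon m) := by
  unfold seqIdeal
  rw [mem_ideal_span_monomial_image]
  constructor
  · intro h m hm hs
    obtain ⟨m', h1, h2⟩ := h m hm
    apply h1
    obtain ⟨t, rfl⟩ := exists_add_of_le h2
    apply stdSeq_down ha _ _ (embMon t) rfl
    rw [embMon, Finsupp.mapDomain_add] at hs
    exact hs
  · intro h m hm
    exact ⟨m, h m hm, le_rfl⟩

lemma seqIdeal_ne_top {a : ℕ → ℕ} (ha : IsOSequence a) (n : ℕ) : seqIdeal a n ≠ ⊤ := by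
  intro h
  have h1 : (1 : MvPolynomial (Fin n) ℚ) ∈ seqIdeal a n := by rw [h]; trivial
  rw [mem_seqIdeal ha] at h1
  apply h1 0 (by simp [mem_support_iff])
  have : embMon (0 : Fin n →₀ ℕ) = 0 := by simp [embMon]
  rw [this]
  exact ⟨fun _ => 0, monotone_const, by simp [monSeq], by simp [rk, ha.1]⟩

lemma seqIdeal_homogeneous {a : ℕ → ℕ} (ha : IsOSequence a) (n : ℕ) :
    IsHomogeneousIdeal (seqIdeal a n) := by
  intro f hf i
  rw [mem_seqIdeal ha] at hf ⊢
  intro m hm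
  apply hf m
  rw [mem_support_iff, coeff_homogeneousComponent] at hm
  rw [mem_support_iff]
  intro h
  apply hm
  rw [h, ite_self]

lemma seqIdeal_hilbert {a : ℕ → ℕ} (ha : IsOSequence a) {n : ℕ} (hn : a 1 ≤ n) (d : ℕ) :
    hilbertFn (seqIdeal a n) d = a d := by
  classical
  set I := seqIdeal a n with hI
  set T : Finset (Fin n →₀ ℕ) := (Finsupp.finite_of_degree_eq (σ := Fin n) d).toFinset.filter
    (fun m => StdSeq a (embMon m)) with hT
  have hmT : ∀ m, m ∈ T ↔ m.degree = d ∧ StdSeq a (embMon m) := by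
    intro m
    simp [hT]
  rw [← card_stdSeq ha hn d T hmT]
  have hind : LinearIndepOn ℚ (monCls I) (T : Set (Fin n →₀ ℕ)) := by
    rw [linearIndepOn_finset_iff]
    intro c hc m hm
    by_contra hne
    have h1 : (∑ i ∈ T, monomial i (c i)) ∈ I := by
      rw [← Ideal.Quotient.eq_zero_iff_mem, ← hc, map_sum]
      apply Finset.sum_congr rfl
      intro i _
      have : monomial i (c i) = c i • monomial i (1:ℚ) := by
        rw [smul_monomial, smul_eq_mul, mul_one]
      rw [this]
      exact map_smul (Ideal.Quotient.mkₐ ℚ I) (c i) (monomial i (1:ℚ))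
    rw [hI, mem_seqIdeal ha] at h1
    apply h1 m _ ((hmT m).1 hm).2
    rw [mem_support_iff, coeff_sum]
    simp only [coeff_monomial]
    rw [Finset.sum_ite_eq' T m, if_pos hm]
    exact hne
  rw [← finrank_of_indep hind, hilbertFn, quotPiece_eq_span]
  have : Submodule.span ℚ (monCls I '' {m | m.degree = d})
      = Submodule.span ℚ (monCls I '' (T : Set (Fin n →₀ ℕ))) := by
    apply le_antisymm
    · rw [Submodule.span_le]
      rintro _ ⟨m, hm, rfl⟩
      by_cases hs : StdSeq a (embMon m)
      · exact Submodule.subset_span ⟨m, (hmT m).2 ⟨hm, hs⟩, rfl⟩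
      · have : monCls I m = 0 := by
          apply Ideal.Quotient.eq_zero_iff_mem.2
          exact Ideal.subset_span ⟨m, hs, rfl⟩
        rw [this]
        exact Submodule.zero_mem _
    · apply Submodule.span_mono
      rintro _ ⟨m, hm, rfl⟩
      exact ⟨m, ((hmT m).1 hm).1, rfl⟩
  rw [this]

theorem macaulay_o_sequences_are_hilbert_functions (a : ℕ → ℕ) :
    IsOSequence a ↔
      ∃ (k : Type) (_ : Field k) (n : ℕ), 1 ≤ n ∧
        ∃ I : Ideal (MvPolynomial (Fin n) k), I ≠ ⊤ ∧ IsHomogeneousIdeal I ∧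
          ∀ i : ℕ, a i = hilbertFn I i := by
  constructor
  · intro ha
    exact ⟨ℚ, inferInstance, max (a 1) 1, le_max_right _ _, seqIdeal a _, seqIdeal_ne_top ha _,
      seqIdeal_homogeneous ha _, fun i => (seqIdeal_hilbert ha (le_max_left _ _) i).symm⟩
  · rintro ⟨k, _, n, _, I, hI, _, h⟩
    have : a = hilbertFn I := funext h
    rw [this]
    exact hilbert_isOSequence I hI
end

section
/- Let H = {h_i} be a twice differentiable O-sequence with h_0 = 1 and h_1 = 4, whose first difference ΔH is eventually constant with value d; let t be the least index with (ΔH)_t = d and set s = ⌊(d−1)/2⌋. If d > 3 and t ≤ s − 1, then (ΔH)_2 = 6. -/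
theorem binomExpTop_small (a i : ℕ) (h0 : a ≠ 0) (h : a ≤ i + 1) :
    binomExpTop a (i + 1) = i + 1 := by
  unfold binomExpTop
  rw [Nat.findGreatest_eq_iff]
  refine ⟨by omega, fun _ => ?_, ?_⟩
  · rw [Nat.choose_self]; omega
  · intro n hn _ hle
    have h1 : Nat.choose (i + 2) (i + 1) ≤ Nat.choose n (i + 1) :=
      Nat.choose_le_choose _ (by omega)
    have h2 : Nat.choose (i + 2) (i + 1) = i + 2 := Nat.choose_succ_self_right (i + 1)
    omega

theorem macaulayGrow_small (i : ℕ) : ∀ a : ℕ, a ≤ i → macaulayGrow i a ≤ a := by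
  induction i with
  | zero => intro a _; simp [macaulayGrow]
  | succ i ih =>
    intro a ha
    rw [macaulayGrow]
    split_ifs with h0
    · omega
    · rw [binomExpTop_small a i h0 ha, Nat.choose_self, Nat.choose_self]
      have := ih (a - 1) (by omega)
      omega

theorem macaulayGrow_one_two : macaulayGrow 1 2 = 3 := by decide

theorem second_difference_value_is_six
    (H b c : ℕ → ℕ) (d t s : ℕ)
    (hH0 : H 0 = 1) (hH1 : H 1 = 4)
    (hb0 : b 0 = H 0) (hb : ∀ i : ℕ, H (i + 1) = H i + b (i + 1))
    (hc0 : c 0 = b 0) (hc : ∀ i : ℕ, b (i + 1) = b i + c (i + 1))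
    (hOH : IsOSequence H) (hOb : IsOSequence b) (hOc : IsOSequence c)
    (hev : ∃ N : ℕ, ∀ i : ℕ, N ≤ i → b i = d)
    (htd : b t = d) (htmin : ∀ i : ℕ, i < t → b i ≠ d)
    (hs : s = (d - 1) / 2)
    (hd : 3 < d) (hts : t ≤ s - 1) :
    b 2 = 6 := by
  have e0 := hb 0
  have e1 := hc 0
  have e2 := hc 1
  simp only [Nat.zero_add, Nat.reduceAdd] at e0 e1 e2
  have c1 : c 1 = 2 := by omega
  have c2 := hOc.2 1 le_rfl
  rw [c1, macaulayGrow_one_two] at c2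
  simp only [Nat.reduceAdd] at c2
  by_contra hne
  have hc2 : c 2 ≤ 2 := by omega
  have hcs : ∀ i, c (i + 2) ≤ 2 := by
    intro i
    induction i with
    | zero => exact hc2
    | succ i ih =>
      have h1 := hOc.2 (i + 2) (by omega)
      have h2 := macaulayGrow_small (i + 2) (c (i + 2)) (by omega)
      exact h1.trans (h2.trans ih)
  have hbs : ∀ i, b i ≤ 1 + 2 * i := by
    intro i
    induction i with
    | zero => omega
    | succ i ih =>
      have h1 := hc i
      have h2 : c (i + 1) ≤ 2 := by
        cases i with
        | zero => exact c1.le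
        | succ j => exact hcs j
      omega
  have := hbs t
  omega
end

section
/- For all integers i ≥ 1 and all integers e with 1 ≤ e ≤ C(i+2, 2), one has (e + 2i + 5)^⟨i+2⟩ = e^⟨i⟩ + 2i + 7. -/
theorem binomExpTop_eq_of (a k m : ℕ) (hm : m ≤ a + k) (h1 : Nat.choose m k ≤ a)
    (h2 : a < Nat.choose (m + 1) k) : binomExpTop a k = m := by
  unfold binomExpTop
  rw [Nat.findGreatest_eq_iff]
  refine ⟨hm, fun _ => h1, fun n hn _ h => ?_⟩
  have := Nat.choose_le_choose k (show m + 1 ≤ n from hn)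
  omega

theorem macaulayGrow_step (a k m : ℕ) (ha : a ≠ 0) (hm : m ≤ a + (k + 1))
    (h1 : Nat.choose m (k + 1) ≤ a) (h2 : a < Nat.choose (m + 1) (k + 1)) :
    macaulayGrow (k + 1) a =
      Nat.choose (m + 1) (k + 2) + macaulayGrow k (a - Nat.choose m (k + 1)) := by
  rw [macaulayGrow, if_neg ha, binomExpTop_eq_of a (k + 1) m hm h1 h2]

theorem macaulayGrow_zero_right (k : ℕ) : macaulayGrow k 0 = 0 := by
  cases k <;> simp [macaulayGrow]

theorem choose_add_one_self (n : ℕ) : Nat.choose (n + 1) n = n + 1 := by simp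

theorem choose_add_two_self (n : ℕ) : Nat.choose (n + 2) n = Nat.choose (n + 2) 2 :=
  Nat.choose_symm_add

theorem choose_two_succ (n : ℕ) : Nat.choose (n + 1) 2 = n + Nat.choose n 2 := by
  rw [Nat.choose_succ_succ' n 1, Nat.choose_one_right]

theorem choose_lt_succ (n : ℕ) : Nat.choose (n + 3) (n + 1) < Nat.choose (n + 4) (n + 1) := by
  rw [Nat.choose_succ_succ' (n + 3) n]
  have := Nat.choose_pos (show n ≤ n + 3 by omega)
  omega

theorem macaulay_growth_shift (i e : ℕ) (hi : 1 ≤ i)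
    (he1 : 1 ≤ e) (he2 : e ≤ Nat.choose (i + 2) 2) :
    macaulayGrow (i + 2) (e + 2 * i + 5) = macaulayGrow i e + 2 * i + 7 := by
  have c3 : Nat.choose (i + 3) 2 = i + 2 + Nat.choose (i + 2) 2 := choose_two_succ (i + 2)
  have c4 : Nat.choose (i + 4) 2 = i + 3 + Nat.choose (i + 3) 2 := choose_two_succ (i + 3)
  have c5 : Nat.choose (i + 5) 2 = i + 4 + Nat.choose (i + 4) 2 := choose_two_succ (i + 4)
  have s2 := choose_add_two_self i
  have s3 : Nat.choose (i + 3) (i + 1) = Nat.choose (i + 3) 2 := choose_add_two_self (i + 1)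
  have s4 : Nat.choose (i + 4) (i + 2) = Nat.choose (i + 4) 2 := choose_add_two_self (i + 2)
  have s5 : Nat.choose (i + 5) (i + 3) = Nat.choose (i + 5) 2 := choose_add_two_self (i + 3)
  have t1 : Nat.choose (i + 2) (i + 1) = i + 2 := choose_add_one_self (i + 1)
  have t2 : Nat.choose (i + 3) (i + 2) = i + 3 := choose_add_one_self (i + 2)
  have t3 : Nat.choose (i + 4) (i + 3) = i + 4 := choose_add_one_self (i + 3)
  rcases Nat.lt_or_eq_of_le he2 with h | h
  · rw [macaulayGrow_step (e + 2 * i + 5) (i + 1) (i + 3) (by omega) (by omega)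
      (by show Nat.choose (i + 3) (i + 2) ≤ _; omega)
      (by show _ < Nat.choose (i + 4) (i + 2); omega)]
    have r1 : e + 2 * i + 5 - Nat.choose (i + 3) (i + 1 + 1) = e + i + 2 := by
      show e + 2 * i + 5 - Nat.choose (i + 3) (i + 2) = _
      omega
    rw [r1, macaulayGrow_step (e + i + 2) i (i + 2) (by omega) (by omega) (by omega)
      (by show _ < Nat.choose (i + 3) (i + 1); omega)]
    have r2 : e + i + 2 - Nat.choose (i + 2) (i + 1) = e := by omega
    rw [r2]
    show Nat.choose (i + 4) (i + 3) + (Nat.choose (i + 3) (i + 2) + _) = _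
    omega
  · rw [macaulayGrow_step (e + 2 * i + 5) (i + 1) (i + 4) (by omega) (by omega)
      (by show Nat.choose (i + 4) (i + 2) ≤ _; omega)
      (by
        show _ < Nat.choose (i + 5) (i + 2)
        have := choose_lt_succ (i + 1)
        change Nat.choose (i + 4) (i + 2) < Nat.choose (i + 5) (i + 2) at this
        omega)]
    have r1 : e + 2 * i + 5 - Nat.choose (i + 4) (i + 1 + 1) = 0 := by
      show e + 2 * i + 5 - Nat.choose (i + 4) (i + 2) = _
      omega
    rw [r1, macaulayGrow_zero_right]
    obtain ⟨j, rfl⟩ : ∃ j, i = j + 1 := ⟨i - 1, by omega⟩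
    have hj : e = j + 2 + Nat.choose (j + 2) 2 := h.trans (choose_two_succ (j + 2))
    rw [macaulayGrow_step e j (j + 3) (by omega) (by omega)
      (by
        change Nat.choose (j + 3) (j + 1) = Nat.choose (j + 3) 2 at s2
        change e = Nat.choose (j + 3) 2 at h
        omega)
      (by
        have := choose_lt_succ j
        change Nat.choose (j + 3) (j + 1) = Nat.choose (j + 3) 2 at s2
        change e = Nat.choose (j + 3) 2 at h
        show _ < Nat.choose (j + 4) (j + 1)
        omega)]
    have r2 : e - Nat.choose (j + 3) (j + 1) = 0 := by
      change Nat.choose (j + 3) (j + 1) = Nat.choose (j + 3) 2 at s2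
      change e = Nat.choose (j + 3) 2 at h
      omega
    rw [r2, macaulayGrow_zero_right]
    show Nat.choose (j + 1 + 5) (j + 1 + 3) + 0 = Nat.choose (j + 1 + 3) (j + 1 + 1) + 0 + _ + 7
    omega
end

section
/- Let R be a commutative ring, I ⊆ R an ideal, F ∈ I, and Q ∈ R. Assume F is a nonzerodivisor on R and Q is a nonzerodivisor on R/(F). Then the sequence of R-modules 0 → R → I ⊕ R → Q·I + (F) → 0 is exact, where the first map sends c to (cF, −cQ), the second map sends (a, b) to Qa + bF, and Q·I + (F) denotes the ideal generated by {Qa : a ∈ I} together with F. In particular, the second map is surjective onto Q·I + (F) and its kernel is the free rank-one submodule generated by (F, −Q). -/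
/-!
STATEMENT 7 (Liaison Addition, special case): for a commutative ring `R`, an
ideal `I`, `F ∈ I` a nonzerodivisor on `R` and `Q` a nonzerodivisor on
`R/(F)`, the sequence `0 → R → I ⊕ R → Q·I + (F) → 0` is exact, where
`c ↦ (cF, −cQ)` and `(a, b) ↦ Qa + bF`.  Exactness is expressed by:
injectivity of the first map, surjectivity of the second map onto the ideal
`Q·I + (F)`, and the fact that the kernel of the second map is exactly the
image of the first map (the free rank-one submodule generated by `(F, −Q)`).
-/

theorem liaison_addition_exact_sequence
    {R : Type*} [CommRing R] (I : Ideal R) (F Q : R) (hFI : F ∈ I)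
    (hFreg : ∀ c : R, c * F = 0 → c = 0)
    (hQreg : ∀ a : R, a * Q ∈ Ideal.span ({F} : Set R) → a ∈ Ideal.span ({F} : Set R)) :
    -- the ideal Q·I + (F)
    let J : Ideal R :=
      Ideal.span ((fun a => Q * a) '' (I : Set R)) ⊔ Ideal.span ({F} : Set R)
    -- the first map c ↦ (cF, −cQ) is injective
    (Function.Injective
      (fun c : R => ((⟨c * F, I.mul_mem_left c hFI⟩ : I), -(c * Q)) : R → I × R)) ∧
    -- the second map (a, b) ↦ Qa + bF takes values in J and is surjective onto J
    (∀ (a : I) (b : R), Q * (a : R) + b * F ∈ J) ∧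
    (∀ y ∈ J, ∃ (a : I) (b : R), Q * (a : R) + b * F = y) ∧
    -- exactness in the middle: the kernel of the second map is the image of the
    -- first map, i.e. the free rank-one submodule generated by (F, −Q)
    (∀ (a : I) (b : R), Q * (a : R) + b * F = 0 ↔
      ∃ c : R, (a : R) = c * F ∧ b = -(c * Q)) := by
  intro J
  refine ⟨?_, ?_, ?_, ?_⟩
  · intro c d h
    have h1 : c * F = d * F := congrArg (fun p : I × R => (p.1 : R)) h
    exact sub_eq_zero.mp (hFreg (c - d) (by rw [sub_mul, h1, sub_self]))
  · intro a b
    exact Submodule.add_mem_sup (Ideal.subset_span ⟨a, a.2, rfl⟩)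
      (Ideal.mul_mem_left _ b (Ideal.subset_span rfl))
  · intro y hy
    obtain ⟨u, hu, v, hv, rfl⟩ := Submodule.mem_sup.mp hy
    obtain ⟨b, rfl⟩ := Ideal.mem_span_singleton'.mp hv
    have key : ∃ a : I, Q * (a : R) = u := by
      refine Submodule.span_induction (p := fun u _ => ∃ a : I, Q * (a : R) = u)
        ?_ ?_ ?_ ?_ hu
      · rintro _ ⟨a, ha, rfl⟩
        exact ⟨⟨a, ha⟩, rfl⟩
      · exact ⟨0, by simp⟩
      · rintro _ _ _ _ ⟨a, rfl⟩ ⟨a', rfl⟩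
        exact ⟨a + a', by simp [mul_add]⟩
      · rintro r _ _ ⟨a, rfl⟩
        exact ⟨r • a, by simp [mul_left_comm]⟩
    obtain ⟨a, rfl⟩ := key
    exact ⟨a, b, rfl⟩
  · intro a b
    constructor
    · intro h
      have h1 : (a : R) * Q ∈ Ideal.span ({F} : Set R) :=
        Ideal.mem_span_singleton'.mpr ⟨-b, by linear_combination -h⟩
      obtain ⟨c, hc⟩ := Ideal.mem_span_singleton'.mp (hQreg _ h1)
      refine ⟨c, hc.symm, ?_⟩
      have h2 := hFreg (b + c * Q) (by linear_combination h + Q * hc)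
      linear_combination h2
    · rintro ⟨c, h1, h2⟩
      rw [h1, h2]
      ring
end

section
/- Let k be a field, R = k[x_0,…,x_n] with n ≥ 1, I_Y ⊆ R a homogeneous ideal, F ∈ I_Y a homogeneous element of degree f ≥ 1, and Q ∈ R a homogeneous element of degree q ≥ 1 such that F, Q is a regular sequence on R. Set I = Q·I_Y + (F). Then for every integer m, dim_k (R/I)_m = dim_k (R/I_Y)_{m−q} + dim_k (R/(F,Q))_m, where graded pieces in negative degrees are taken to be zero. -/
/-!
STATEMENT 9 (Hilbert function of Liaison Addition): for `R = k[x_0,…,x_n]`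
(`n ≥ 1`), a homogeneous ideal `I_Y`, homogeneous `F ∈ I_Y` of degree `f ≥ 1`
and homogeneous `Q` of degree `q ≥ 1` with `F, Q` a regular sequence on `R`,
the ideal `I = Q·I_Y + (F)` satisfies
`dim_k (R/I)_m = dim_k (R/I_Y)_{m−q} + dim_k (R/(F,Q))_m` for every `m`
(graded pieces in negative degrees being zero).
-/

open MvPolynomial

lemma homComp_mul_right {k : Type*} [Field k] {n : ℕ} (a b : MvPolynomial (Fin n) k) (i m : ℕ)
    (hb : b.IsHomogeneous i) :
    homogeneousComponent m (a * b)
      = if i ≤ m then homogeneousComponent (m - i) a * b else 0 := by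
  let := MvPolynomial.gradedAlgebra (σ := Fin n) (R := k)
  have h := DirectSum.coe_decompose_mul_of_right_mem (homogeneousSubmodule (Fin n) k) (a := a) m
    ((mem_homogeneousSubmodule i b).2 hb)
  have e : ∀ (j : ℕ) (p : MvPolynomial (Fin n) k),
      (DirectSum.decompose (homogeneousSubmodule (Fin n) k) p j : MvPolynomial (Fin n) k)
        = homogeneousComponent j p := fun j p => decomposition.decompose'_apply p j
  rw [e, e] at h
  exact h

lemma quotPiece_finite {k : Type*} [Field k] {n : ℕ}
    (I : Ideal (MvPolynomial (Fin n) k)) (i : ℕ) : Module.Finite k (quotPiece I i) :=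
  Module.Finite.iff_fg.2 ((MvPolynomial.homogeneousSubmodule_fg (Fin n) k i).map _)

lemma finrank_map_add_inf {k V W : Type*} [Field k] [AddCommGroup V] [AddCommGroup W]
    [Module k V] [Module k W] (g : V →ₗ[k] W) (S : Submodule k V) [Module.Finite k S] :
    Module.finrank k S
      = Module.finrank k (S ⊓ LinearMap.ker g : Submodule k V) + Module.finrank k (S.map g) := by
  have h := (g.domRestrict S).finrank_range_add_finrank_ker
  rw [LinearMap.range_domRestrict, LinearMap.ker_domRestrict] at h
  rw [← h, add_comm]
  congr 1
  rw [LinearEquiv.finrank_eq (Submodule.equivSubtypeMap S (Submodule.comap S.subtype (LinearMap.ker g)))]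
  rw [Submodule.map_comap_subtype]

theorem liaison_addition_hilbert_function
    (k : Type) [Field k] (n : ℕ) (hn : 1 ≤ n)
    (IY : Ideal (MvPolynomial (Fin (n + 1)) k)) (hIY : IsHomogeneousIdeal IY)
    (F Q : MvPolynomial (Fin (n + 1)) k) (f q : ℕ) (hf : 1 ≤ f) (hq : 1 ≤ q)
    (hFmem : F ∈ IY)
    (hFhom : F.IsHomogeneous f) (hQhom : Q.IsHomogeneous q)
    (hFreg : ∀ c : MvPolynomial (Fin (n + 1)) k, c * F = 0 → c = 0)
    (hQreg : ∀ a : MvPolynomial (Fin (n + 1)) k,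
      a * Q ∈ Ideal.span ({F} : Set (MvPolynomial (Fin (n + 1)) k)) →
        a ∈ Ideal.span ({F} : Set (MvPolynomial (Fin (n + 1)) k))) :
    ∀ m : ℕ,
      hilbertFn (Ideal.span ((fun a => Q * a) '' (IY : Set (MvPolynomial (Fin (n + 1)) k)))
          ⊔ Ideal.span ({F} : Set (MvPolynomial (Fin (n + 1)) k))) m
        = (if q ≤ m then hilbertFn IY (m - q) else 0)
          + hilbertFn (Ideal.span ({F, Q} : Set (MvPolynomial (Fin (n + 1)) k))) m := by
  intro m
  set I := Ideal.span ((fun a => Q * a) '' (IY : Set (MvPolynomial (Fin (n + 1)) k)))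
          ⊔ Ideal.span ({F} : Set (MvPolynomial (Fin (n + 1)) k)) with hI
  set J := Ideal.span ({F, Q} : Set (MvPolynomial (Fin (n + 1)) k)) with hJ
  have hFJ : F ∈ J := Ideal.subset_span (by simp)
  have hQJ : Q ∈ J := Ideal.subset_span (by simp)
  have hFI : F ∈ I := Ideal.mem_sup_right (Ideal.subset_span rfl)
  have hQI : ∀ a ∈ IY, Q * a ∈ I := fun a ha =>
    Ideal.mem_sup_left (Ideal.subset_span ⟨a, ha, rfl⟩)
  have hIJ : I ≤ J := by
    refine sup_le (Ideal.span_le.2 ?_) (Ideal.span_le.2 ?_)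
    · rintro _ ⟨a, -, rfl⟩
      exact J.mul_mem_right a hQJ
    · rintro _ rfl
      exact hFJ
  have hImem : ∀ p ∈ I, ∃ b ∈ IY, ∃ c, p = Q * b + c * F := by
    intro p hp
    obtain ⟨u, hu, v, hv, rfl⟩ := Submodule.mem_sup.1 hp
    obtain ⟨c, rfl⟩ := Ideal.mem_span_singleton'.1 hv
    suffices h : ∃ b ∈ IY, u = Q * b by
      obtain ⟨b, hb, rfl⟩ := h
      exact ⟨b, hb, c, rfl⟩
    clear hp hv
    induction hu using Submodule.span_induction with
    | mem x hx => obtain ⟨a, ha, rfl⟩ := hx; exact ⟨a, ha, rfl⟩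
    | zero => exact ⟨0, IY.zero_mem, by simp⟩
    | add x y _ _ hx hy =>
      obtain ⟨a, ha, rfl⟩ := hx
      obtain ⟨b, hb, rfl⟩ := hy
      exact ⟨a + b, IY.add_mem ha hb, by ring⟩
    | smul r x _ hx =>
      obtain ⟨a, ha, rfl⟩ := hx
      exact ⟨r * a, IY.mul_mem_left r ha, by simp only [smul_eq_mul]; ring⟩
  have hinj : ∀ a, Q * a ∈ I → a ∈ IY := by
    intro a ha
    obtain ⟨b, hb, c, h⟩ := hImem _ ha
    have h1 : a - b ∈ Ideal.span ({F} : Set (MvPolynomial (Fin (n + 1)) k)) := by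
      apply hQreg
      exact Ideal.mem_span_singleton'.2 ⟨c, by linear_combination -h⟩
    obtain ⟨d, hd⟩ := Ideal.mem_span_singleton'.1 h1
    have : a = b + d * F := by linear_combination -hd
    rw [this]
    exact IY.add_mem hb (IY.mul_mem_left d hFmem)
  let g : (MvPolynomial (Fin (n + 1)) k ⧸ I) →ₗ[k] (MvPolynomial (Fin (n + 1)) k ⧸ J) :=
    (Ideal.Quotient.factorₐ k hIJ).toLinearMap
  have hg : ∀ p, g (Ideal.Quotient.mk I p) = Ideal.Quotient.mk J p := fun p => rfl
  let h : (MvPolynomial (Fin (n + 1)) k ⧸ IY) →ₗ[k] (MvPolynomial (Fin (n + 1)) k ⧸ I) :=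
    (Submodule.mapQ IY I (LinearMap.mulLeft (MvPolynomial (Fin (n + 1)) k) Q)
      (fun a ha => hQI a ha)).restrictScalars k
  have hh : ∀ p, h (Ideal.Quotient.mk IY p) = Ideal.Quotient.mk I (Q * p) := fun p => rfl
  have hhinj : Function.Injective h := by
    rw [injective_iff_map_eq_zero]
    intro x hx
    obtain ⟨p, rfl⟩ := Ideal.Quotient.mk_surjective x
    rw [hh, Ideal.Quotient.eq_zero_iff_mem] at hx
    exact Ideal.Quotient.eq_zero_iff_mem.2 (hinj p hx)
  have hmap : (quotPiece I m).map g = quotPiece J m := by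
    unfold quotPiece
    rw [← Submodule.map_comp]
    rfl
  have hmemP : ∀ (K : Ideal (MvPolynomial (Fin (n + 1)) k)) (i : ℕ) x, x ∈ quotPiece K i ↔
      ∃ p : MvPolynomial (Fin (n + 1)) k, p.IsHomogeneous i ∧ Ideal.Quotient.mk K p = x :=
    fun K i x => Iff.rfl
  haveI := quotPiece_finite I m
  have hker : quotPiece I m ⊓ LinearMap.ker g
      = if q ≤ m then (quotPiece IY (m - q)).map h else ⊥ := by
    apply le_antisymm
    · rintro x ⟨hx, hx0⟩
      obtain ⟨p, hp, rfl⟩ := (hmemP _ _ _).1 hx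
      have hpJ : p ∈ J := by
        rw [← Ideal.Quotient.eq_zero_iff_mem, ← hg]
        exact hx0
      obtain ⟨a, b, hab⟩ := Ideal.mem_span_pair.1 hpJ
      have hc : p = homogeneousComponent m (a * F) + homogeneousComponent m (b * Q) := by
        rw [← map_add, hab, homogeneousComponent_eq_self hp]
      have hF' : homogeneousComponent m (a * F) ∈ I := by
        rw [homComp_mul_right _ _ _ _ hFhom]
        split_ifs
        · exact I.mul_mem_left _ hFI
        · exact I.zero_mem
      have hx' : Ideal.Quotient.mk I p = Ideal.Quotient.mk I (homogeneousComponent m (b * Q)) := by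
        rw [Ideal.Quotient.eq]
        have : p - homogeneousComponent m (b * Q) = homogeneousComponent m (a * F) := by
          rw [sub_eq_iff_eq_add]; exact hc
        rwa [this]
      rw [hx', homComp_mul_right _ _ _ _ hQhom]
      split_ifs with hqm
      · refine ⟨Ideal.Quotient.mk IY (homogeneousComponent (m - q) b), ?_, ?_⟩
        · exact (hmemP _ _ _).2 ⟨_, homogeneousComponent_isHomogeneous _ _, rfl⟩
        · rw [hh, mul_comm]
      · simp
    · split_ifs with hqm
      · rintro _ ⟨y, hy, rfl⟩
        obtain ⟨p, hp, rfl⟩ := (hmemP _ _ _).1 hy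
        rw [hh]
        refine ⟨(hmemP _ _ _).2 ⟨Q * p, ?_, rfl⟩, ?_⟩
        · have := hQhom.mul hp
          rwa [Nat.add_sub_cancel' hqm] at this
        · change g _ = 0
          rw [hg, Ideal.Quotient.eq_zero_iff_mem]
          exact J.mul_mem_right p hQJ
      · exact bot_le
  unfold hilbertFn
  rw [finrank_map_add_inf g (quotPiece I m), hmap]
  congr 1
  by_cases hqm : q ≤ m
  · rw [if_pos hqm] at hker ⊢
    rw [hker]
    exact (LinearEquiv.finrank_eq
      (Submodule.equivMapOfInjective h hhinj (quotPiece IY (m - q)))).symm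
  · rw [if_neg hqm] at hker ⊢
    rw [hker, finrank_bot]
end

section
/- Let k be a field, R = k[x_0,…,x_n] with n ≥ 2, and m = (x_0,…,x_n) the irrelevant maximal ideal. Let I_Y ⊆ R be a homogeneous ideal that is saturated, i.e., (I_Y : m) = I_Y. Let F ∈ I_Y and Q ∈ R be homogeneous elements such that F, Q is a regular sequence on R. Then the ideal I = Q·I_Y + (F) is saturated: (I : m) = I. -/
/-!
STATEMENT 10: for `R = k[x_0,…,x_n]` (`n ≥ 2`) with irrelevant maximal ideal
`m = (x_0,…,x_n)`, if `I_Y` is a saturated homogeneous ideal, `F ∈ I_Y` and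
`Q` are homogeneous, and `F, Q` is a regular sequence on `R`, then
`I = Q·I_Y + (F)` is saturated, i.e. `(I : m) = I`.
-/

open MvPolynomial

/-- The irrelevant maximal ideal `(x_0, …, x_n)` of `k[x_0,…,x_n]`. -/
noncomputable def irrelevantIdeal (k : Type*) [Field k] (n : ℕ) :
    Ideal (MvPolynomial (Fin (n + 1)) k) :=
  Ideal.span (Set.range (MvPolynomial.X : Fin (n + 1) → MvPolynomial (Fin (n + 1)) k))

theorem aux_mem_span {k : Type} [Field k] {n : ℕ} {i0 i1 i2 : Fin (n + 1)}
    (h02 : i0 ≠ i2) (h12 : i1 ≠ i2)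
    (g u v : MvPolynomial (Fin (n + 1)) k)
    (h : X i2 * g = X i0 * u + X i1 * v) :
    ∃ d0 d1, g = X i1 * d0 - X i0 * d1 := by
  have key : g ∈ Ideal.span ((X : Fin (n + 1) → MvPolynomial (Fin (n + 1)) k) '' {i0, i1}) := by
    have h1 : X i2 * g ∈
        Ideal.span ((X : Fin (n + 1) → MvPolynomial (Fin (n + 1)) k) '' {i0, i1}) := by
      rw [h]
      exact add_mem (Ideal.mul_mem_right _ _ (Ideal.subset_span ⟨i0, by simp, rfl⟩))
        (Ideal.mul_mem_right _ _ (Ideal.subset_span ⟨i1, by simp, rfl⟩))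
    rw [mem_ideal_span_X_image] at h1 ⊢
    intro m hm
    have h2 : Finsupp.single i2 1 + m ∈ (X i2 * g).support := by
      rw [mem_support_iff, coeff_X_mul]
      exact mem_support_iff.mp hm
    obtain ⟨i, hi, hne⟩ := h1 _ h2
    refine ⟨i, hi, ?_⟩
    have hi2 : i2 ≠ i := by
      rcases hi with rfl | hi
      · exact h02.symm
      · rw [Set.mem_singleton_iff] at hi
        subst hi
        exact h12.symm
    simpa [Finsupp.single_apply, hi2] using hne
  rw [Set.image_pair, Ideal.mem_span_pair] at key
  obtain ⟨a, b, hab⟩ := key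
  exact ⟨b, -a, by rw [← hab]; ring⟩

theorem aux_dvd {k : Type} [Field k] {n : ℕ} {i0 i1 : Fin (n + 1)}
    (h01 : i0 ≠ i1) (b c : MvPolynomial (Fin (n + 1)) k)
    (h : X i1 * b = X i0 * c) : ∃ d, b = X i0 * d ∧ c = X i1 * d := by
  have hx : (X i0 : MvPolynomial (Fin (n + 1)) k) ≠ 0 := X_ne_zero _
  obtain ⟨d0, d1, hd⟩ := aux_mem_span (i0 := i0) (i1 := i0) h01 h01 b c 0 (by rw [h]; ring)
  refine ⟨d0 - d1, by rw [hd]; ring, ?_⟩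
  apply mul_left_cancel₀ hx
  rw [← h, hd]
  ring

theorem liaison_addition_saturated
    (k : Type) [Field k] (n : ℕ) (hn : 2 ≤ n)
    (IY : Ideal (MvPolynomial (Fin (n + 1)) k)) (hIY : IsHomogeneousIdeal IY)
    (hIYsat : Submodule.colon IY (irrelevantIdeal k n) = IY)
    (F Q : MvPolynomial (Fin (n + 1)) k) (f q : ℕ)
    (hFmem : F ∈ IY)
    (hFhom : F.IsHomogeneous f) (hQhom : Q.IsHomogeneous q)
    (hFreg : ∀ c : MvPolynomial (Fin (n + 1)) k, c * F = 0 → c = 0)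
    (hQreg : ∀ a : MvPolynomial (Fin (n + 1)) k,
      a * Q ∈ Ideal.span ({F} : Set (MvPolynomial (Fin (n + 1)) k)) →
        a ∈ Ideal.span ({F} : Set (MvPolynomial (Fin (n + 1)) k))) :
    Submodule.colon
        (Ideal.span ((fun a => Q * a) '' (IY : Set (MvPolynomial (Fin (n + 1)) k)))
          ⊔ Ideal.span ({F} : Set (MvPolynomial (Fin (n + 1)) k)))
        (irrelevantIdeal k n)
      = Ideal.span ((fun a => Q * a) '' (IY : Set (MvPolynomial (Fin (n + 1)) k)))
          ⊔ Ideal.span ({F} : Set (MvPolynomial (Fin (n + 1)) k)) := by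
  have hF0 : F ≠ 0 := by
    intro h0
    exact one_ne_zero (hFreg 1 (by rw [h0, mul_zero]))
  have hmem : ∀ a, a ∈ Ideal.span ((fun a => Q * a) '' (IY : Set (MvPolynomial (Fin (n + 1)) k)))
          ⊔ Ideal.span ({F} : Set (MvPolynomial (Fin (n + 1)) k)) →
      ∃ b ∈ IY, ∃ c, a = Q * b + F * c := by
    intro a ha
    obtain ⟨y, hy, z, hz, rfl⟩ := Submodule.mem_sup.mp ha
    obtain ⟨c, rfl⟩ := Ideal.mem_span_singleton'.mp hz
    have : ∃ b ∈ IY, y = Q * b := by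
      refine Submodule.span_induction (p := fun y _ => ∃ b ∈ IY, y = Q * b) ?_ ?_ ?_ ?_ hy
      · rintro _ ⟨b, hb, rfl⟩
        exact ⟨b, hb, rfl⟩
      · exact ⟨0, IY.zero_mem, by ring⟩
      · rintro _ _ _ _ ⟨b, hb, rfl⟩ ⟨b', hb', rfl⟩
        exact ⟨b + b', IY.add_mem hb hb', by ring⟩
      · rintro r _ _ ⟨b, hb, rfl⟩
        exact ⟨r * b, IY.mul_mem_left r hb, by rw [smul_eq_mul]; ring⟩
    obtain ⟨b, hb, rfl⟩ := this
    exact ⟨b, hb, c, by ring⟩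
  have hQF : ∀ u v : MvPolynomial (Fin (n + 1)) k, Q * u = F * v → ∃ e, u = F * e ∧ v = Q * e := by
    intro u v huv
    obtain ⟨e, he⟩ := Ideal.mem_span_singleton'.mp
      (hQreg u (Ideal.mem_span_singleton'.mpr ⟨v, by rw [mul_comm v, ← huv, mul_comm]⟩))
    refine ⟨e, by rw [← he, mul_comm], ?_⟩
    apply mul_left_cancel₀ hF0
    rw [← huv, ← he]
    ring
  apply le_antisymm
  · intro a ha
    have hax : ∀ i : Fin (n + 1), ∃ b ∈ IY, ∃ c, a * X i = Q * b + F * c := fun i =>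
      hmem _ (Submodule.mem_colon.mp ha _ (Ideal.subset_span ⟨i, rfl⟩))
    choose b hb c hc using hax
    obtain ⟨i0, i1, i2, h01, h02, h12⟩ : ∃ i0 i1 i2 : Fin (n + 1), i0 ≠ i1 ∧ i0 ≠ i2 ∧ i1 ≠ i2 :=
      ⟨⟨0, by omega⟩, ⟨1, by omega⟩, ⟨2, by omega⟩, by simp, by simp, by simp⟩
    have hE : ∀ i j, ∃ e, X j * b i - X i * b j = F * e ∧ X i * c j - X j * c i = Q * e := by
      intro i j
      apply hQF
      linear_combination X i * hc j - X j * hc i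
    obtain ⟨e01, hb01, hc01⟩ := hE i0 i1
    obtain ⟨e02, hb02, hc02⟩ := hE i0 i2
    obtain ⟨e12, hb12, hc12⟩ := hE i1 i2
    have hco : X i2 * e01 = X i0 * (-e12) + X i1 * e02 := by
      apply mul_left_cancel₀ hF0
      linear_combination -X i2 * hb01 + X i1 * hb02 - X i0 * hb12
    obtain ⟨d0, d1, hd⟩ := aux_mem_span h02 h12 _ _ _ hco
    obtain ⟨β, hβ, -⟩ := aux_dvd h01 (b i0 - F * d0) (b i1 - F * d1)
      (by linear_combination hb01 + F * hd)
    obtain ⟨γ, hγ, -⟩ := aux_dvd h01 (c i0 + Q * d0) (c i1 + Q * d1)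
      (by linear_combination -hc01 - Q * hd)
    have haβ : a = Q * β + F * γ := by
      apply mul_left_cancel₀ (X_ne_zero (R := k) i0)
      linear_combination hc i0 + Q * hβ + F * hγ
    have hβmem : β ∈ IY := by
      rw [← hIYsat, Submodule.mem_colon]
      have hle : irrelevantIdeal k n ≤ Submodule.comap (LinearMap.mulLeft _ β) IY := by
        refine Ideal.span_le.mpr ?_
        rintro _ ⟨i, rfl⟩
        show β * X i ∈ IY
        obtain ⟨e, he, -⟩ := hQF (β * X i - b i) (c i - γ * X i)
          (by linear_combination hc i - X i * haβ)
        have : β * X i = b i + e * F := by linear_combination he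
        rw [this]
        exact IY.add_mem (hb i) (IY.mul_mem_left _ hFmem)
      intro p hp
      exact hle hp
    rw [haβ]
    exact add_mem (Ideal.mem_sup_left (Ideal.subset_span ⟨β, hβmem, rfl⟩))
      (Ideal.mem_sup_right (Ideal.mul_mem_right _ _ (Ideal.subset_span rfl)))
  · intro a ha
    rw [Submodule.mem_colon]
    intro p _
    exact Ideal.mul_mem_right _ _ ha
end
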